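/- arXiv:1010.4909 — 2 statements merged into one kernel-verified Lean document; each statement's English description precedes it below -/
import Mathlib

section
/- Let n ≥ 3 and let F be an odd-cycle-agreeing family of subgraphs of the complete graph K_n. Then |F| ≤ (1/8)·2^(C(n,2)), and equality holds if and only if F is a triangle junta, i.e. there exist a triangle T and a subset S ⊆ T such that F = {G ⊆ E_n : G ∩ T = S}. -/
/-- The edge set of the complete graph `K_n` on vertex set `Fin n`:
all non-diagonal unordered pairs. -/
def edgeFinset (n : ℕ) : Finset (Sym2 (Fin n)) :=
  Finset.univ.filter (fun e => ¬ e.IsDiag)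

/-- `T` is a triangle: the three edges on three distinct vertices. -/
def IsTriangle {n : ℕ} (T : Finset (Sym2 (Fin n))) : Prop :=
  ∃ a b c : Fin n, a ≠ b ∧ a ≠ c ∧ b ≠ c ∧ T = {s(a, b), s(a, c), s(b, c)}

/-- The simple graph on `Fin n` with edge set `G`. -/
def graphOf {n : ℕ} (G : Finset (Sym2 (Fin n))) : SimpleGraph (Fin n) :=
  SimpleGraph.fromEdgeSet (G : Set (Sym2 (Fin n)))

/-- The graph `G` contains a cycle of odd length. -/
def HasOddCycle {n : ℕ} (G : Finset (Sym2 (Fin n))) : Prop :=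
  ∃ (v : Fin n) (w : (graphOf G).Walk v v), w.IsCycle ∧ Odd w.length

/-- A family of graphs is odd-cycle-agreeing if for any two members `G, H`,
the complement (within `E_n`) of the symmetric difference `G Δ H` contains an
odd cycle. -/
def OddCycleAgreeing (n : ℕ) (F : Finset (Finset (Sym2 (Fin n)))) : Prop :=
  ∀ G ∈ F, ∀ H ∈ F, HasOddCycle (edgeFinset n \ ((G \ H) ∪ (H \ G)))

section Walsh

variable {ι : Type*} [DecidableEq ι]

/-- The Walsh character `(-1) ^ |S ∩ G|`. -/
def walsh (S G : Finset ι) : ℝ := (-1) ^ (S ∩ G).card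

lemma walsh_comm (S G : Finset ι) : walsh S G = walsh G S := by
  simp [walsh, Finset.inter_comm]

lemma walsh_empty_left (G : Finset ι) : walsh ∅ G = 1 := by simp [walsh]

lemma walsh_mul_self (S G : Finset ι) : walsh S G * walsh S G = 1 := by
  rw [walsh, ← pow_add, Even.neg_one_pow ⟨_, rfl⟩]

lemma walsh_eq_prod (S G : Finset ι) :
    walsh S G = ∏ e ∈ G, if e ∈ S then (-1 : ℝ) else 1 := by
  rw [Finset.prod_ite_mem, Finset.prod_const, walsh, Finset.inter_comm]

lemma walsh_symmDiff_left (S T G : Finset ι) :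
    walsh (symmDiff S T) G = walsh S G * walsh T G := by
  simp only [walsh_eq_prod, ← Finset.prod_mul_distrib]
  refine Finset.prod_congr rfl fun e _ => ?_
  by_cases h₁ : e ∈ S <;> by_cases h₂ : e ∈ T <;> simp [Finset.mem_symmDiff, h₁, h₂]

lemma walsh_symmDiff_right (S G H : Finset ι) :
    walsh S (symmDiff G H) = walsh S G * walsh S H := by
  rw [walsh_comm, walsh_symmDiff_left, walsh_comm G, walsh_comm H]

lemma sum_powerset_walsh (E S : Finset ι) :
    ∑ G ∈ E.powerset, walsh S G = if S ∩ E = ∅ then (2 : ℝ) ^ E.card else 0 := by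
  simp only [walsh_eq_prod]
  rw [← Finset.prod_one_add]
  split_ifs with h
  · rw [Finset.prod_congr rfl (g := fun _ => (2 : ℝ)), Finset.prod_const]
    intro e he
    have : e ∉ S := fun heS => by
      have := Finset.mem_inter.2 ⟨heS, he⟩
      simp [h] at this
    norm_num [this]
  · obtain ⟨e, he⟩ := Finset.nonempty_iff_ne_empty.2 h
    rw [Finset.mem_inter] at he
    exact Finset.prod_eq_zero he.2 (by simp [he.1])

/-- The unnormalised Walsh coefficient of the indicator function of the family `F`. -/
def walshCoeff (F : Finset (Finset ι)) (S : Finset ι) : ℝ := ∑ G ∈ F, walsh S G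

lemma walshCoeff_empty (F : Finset (Finset ι)) : walshCoeff F ∅ = F.card := by
  simp [walshCoeff, walsh_empty_left]

lemma symmDiff_inter_eq_empty_iff {B Q S : Finset ι} (hQ : Q ⊆ B) :
    symmDiff Q S ∩ B = ∅ ↔ S ∩ B = Q := by
  simp only [Finset.ext_iff, Finset.mem_inter, Finset.mem_symmDiff, Finset.notMem_empty]
  refine forall_congr' fun e => ?_
  have := @hQ e
  tauto

lemma sum_walsh_mul_sq_walshCoeff (E K : Finset ι) (F : Finset (Finset ι)) :
    ∑ S ∈ E.powerset, walsh S K * walshCoeff F S ^ 2 =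
      ∑ G ∈ F, ∑ H ∈ F,
        if symmDiff (symmDiff K G) H ∩ E = ∅ then (2 : ℝ) ^ E.card else 0 := by
  simp only [← sum_powerset_walsh, walsh_symmDiff_left]
  have (S : Finset ι) : walsh S K * walshCoeff F S ^ 2 =
      ∑ G ∈ F, ∑ H ∈ F, walsh K S * walsh G S * walsh H S := by
    rw [walshCoeff, sq, Finset.sum_mul_sum, Finset.mul_sum]
    refine Finset.sum_congr rfl fun G _ => ?_
    rw [Finset.mul_sum]
    refine Finset.sum_congr rfl fun H _ => ?_
    rw [walsh_comm K, walsh_comm G, walsh_comm H, mul_assoc]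
  simp only [this]
  rw [Finset.sum_comm]
  exact Finset.sum_congr rfl fun G _ => Finset.sum_comm

lemma sum_sq_walshCoeff {E : Finset ι} {F : Finset (Finset ι)} (hF : F ⊆ E.powerset) :
    ∑ S ∈ E.powerset, walshCoeff F S ^ 2 = 2 ^ E.card * F.card := by
  have h := sum_walsh_mul_sq_walshCoeff E ∅ F
  simp only [walsh_comm _ ∅, walsh_empty_left, one_mul] at h
  rw [h, Finset.sum_congr rfl (g := fun _ => (2 : ℝ) ^ E.card), Finset.sum_const, nsmul_eq_mul,
    mul_comm]
  intro G hG
  rw [Finset.sum_congr rfl (g := fun H => if H = G then (2 : ℝ) ^ E.card else 0)]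
  · simp [hG]
  · intro H hH
    have hG' := Finset.mem_powerset.1 (hF hG)
    have hH' := Finset.mem_powerset.1 (hF hH)
    rw [← Finset.bot_eq_empty, bot_symmDiff, Finset.bot_eq_empty]
    simp only [symmDiff_inter_eq_empty_iff hG', Finset.inter_eq_left.2 hH']

lemma walsh_inversion {E G : Finset ι} {F : Finset (Finset ι)} (hF : F ⊆ E.powerset)
    (hG : G ⊆ E) :
    ∑ S ∈ E.powerset, walshCoeff F S * walsh S G = if G ∈ F then (2 : ℝ) ^ E.card else 0 := by
  simp only [walshCoeff, Finset.sum_mul]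
  rw [Finset.sum_comm,
    Finset.sum_congr rfl (g := fun H => if H = G then (2 : ℝ) ^ E.card else 0)]
  · simp
  · intro H hH
    have hH' := Finset.mem_powerset.1 (hF hH)
    simp only [← walsh_symmDiff_right, fun S => walsh_comm S (symmDiff H G)]
    rw [sum_powerset_walsh, symmDiff_comm]
    simp only [symmDiff_inter_eq_empty_iff hG, Finset.inter_eq_left.2 hH']

/-- Coefficients over the coset `S ∩ B = Q` cancel, if no two members of `F` agree only
inside `B`. -/
lemma sum_coset_sq_walshCoeff_eq_zero {E B Q : Finset ι} {F : Finset (Finset ι)}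
    (hB : ∀ G ∈ F, ∀ H ∈ F, ∃ e ∈ E, (e ∈ G ↔ e ∈ H) ∧ e ∉ B) (hQ : Q ⊆ B) :
    ∑ S ∈ E.powerset with S ∩ B = Q, (-1 : ℝ) ^ S.card * walshCoeff F S ^ 2 = 0 := by
  have h₁ : ∀ R ∈ B.powerset,
      ∑ S ∈ E.powerset, walsh S (symmDiff E R) * walshCoeff F S ^ 2 = 0 := by
    intro R hR
    rw [sum_walsh_mul_sq_walshCoeff]
    refine Finset.sum_eq_zero fun G hG => Finset.sum_eq_zero fun H hH => if_neg fun h => ?_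
    obtain ⟨e, heE, heGH, heB⟩ := hB G hG H hH
    have heR : e ∉ R := fun h => heB (Finset.mem_powerset.1 hR h)
    have : e ∈ symmDiff (symmDiff (symmDiff E R) G) H ∩ E := by
      simp only [Finset.mem_inter, Finset.mem_symmDiff]
      tauto
    simp [h] at this
  have h₂ : ∑ R ∈ B.powerset, walsh Q R *
      ∑ S ∈ E.powerset, walsh S (symmDiff E R) * walshCoeff F S ^ 2 = 0 :=
    Finset.sum_eq_zero fun R hR => by rw [h₁ R hR, mul_zero]
  simp only [Finset.mul_sum] at h₂
  rw [Finset.sum_comm, Finset.sum_congr rfl (g := fun S => (2 : ℝ) ^ B.card *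
    if S ∩ B = Q then (-1 : ℝ) ^ S.card * walshCoeff F S ^ 2 else 0), ← Finset.mul_sum,
    ← Finset.sum_filter] at h₂
  · simpa using h₂
  · intro S hS
    have hS' := Finset.inter_eq_left.2 (Finset.mem_powerset.1 hS)
    have : ∀ R, walsh Q R * (walsh S (symmDiff E R) * walshCoeff F S ^ 2) =
        walsh (symmDiff Q S) R * ((-1 : ℝ) ^ S.card * walshCoeff F S ^ 2) := by
      intro R
      rw [walsh_symmDiff_left, walsh_symmDiff_right, walsh.eq_1 S E, hS']
      ring
    simp only [this]
    rw [← Finset.sum_mul, sum_powerset_walsh]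
    simp only [symmDiff_inter_eq_empty_iff hQ]
    split_ifs <;> ring

lemma sum_neg_one_pow_mul_sq_walshCoeff_eq_zero {E B : Finset ι} {F : Finset (Finset ι)}
    (hB : ∀ G ∈ F, ∀ H ∈ F, ∃ e ∈ E, (e ∈ G ↔ e ∈ H) ∧ e ∉ B) (φ : ℕ → ℝ) :
    ∑ S ∈ E.powerset, (-1 : ℝ) ^ S.card * φ (S ∩ B).card * walshCoeff F S ^ 2 = 0 := by
  rw [← Finset.sum_fiberwise_of_maps_to (t := B.powerset) (g := fun S => S ∩ B)
    (fun S _ => Finset.mem_powerset.2 Finset.inter_subset_right)]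
  refine Finset.sum_eq_zero fun Q hQ => ?_
  rw [← mul_zero (φ Q.card),
    ← sum_coset_sq_walshCoeff_eq_zero hB (Finset.mem_powerset.1 hQ), Finset.mul_sum]
  refine Finset.sum_congr rfl fun S hS => ?_
  rw [(Finset.mem_filter.1 hS).2]
  ring

end Walsh

section CutDistribution

variable {ι G : Type*} [CommGroup G]

/-- The number of members of `S` whose character takes the value `-1` at `c`. -/
def cutSize (Y : ι → G →* ℤˣ) (S : Finset ι) (c : G) : ℕ := (S.filter fun e => Y e c = -1).card

/-- The sum of the signs of the members of `S` at `c`. -/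
def signSum (Y : ι → G →* ℤˣ) (S : Finset ι) (c : G) : ℝ := ∑ e ∈ S, ((Y e c : ℤ) : ℝ)

lemma cutSize_le (Y : ι → G →* ℤˣ) (S : Finset ι) (c : G) : cutSize Y S c ≤ S.card :=
  Finset.card_filter_le _ _

lemma signSum_eq (Y : ι → G →* ℤˣ) (S : Finset ι) (c : G) :
    signSum Y S c = S.card - 2 * cutSize Y S c := by
  have : ∀ e ∈ S, ((Y e c : ℤ) : ℝ) = 1 - 2 * if Y e c = -1 then 1 else 0 := by
    intro e _
    rcases Int.units_eq_one_or (Y e c) with h | h <;> rw [h] <;> norm_num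
  rw [signSum, Finset.sum_congr rfl this, Finset.sum_sub_distrib, ← Finset.mul_sum, cutSize]
  simp

lemma prod_sign_eq (Y : ι → G →* ℤˣ) (S : Finset ι) (c : G) :
    (∏ e ∈ S, Y e) c = (-1) ^ cutSize Y S c := by
  have : ∀ e ∈ S, Y e c = if Y e c = -1 then -1 else 1 := by
    intro e _
    rcases Int.units_eq_one_or (Y e c) with h | h <;> rw [h] <;> simp
  rw [MonoidHom.finsetProd_apply, Finset.prod_congr rfl this, Finset.prod_ite]
  simp [cutSize]

variable [Fintype G]

/-- The probability that `cutSize` takes the value `i` at a uniformly random point. -/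
noncomputable def cutProb (Y : ι → G →* ℤˣ) (S : Finset ι) (i : ℕ) : ℝ :=
  ((Finset.univ.filter fun c => cutSize Y S c = i).card : ℝ) / Fintype.card G

lemma cutProb_nonneg (Y : ι → G →* ℤˣ) (S : Finset ι) (i : ℕ) : 0 ≤ cutProb Y S i := by
  unfold cutProb; positivity

lemma sum_comp_cutSize (Y : ι → G →* ℤˣ) (S : Finset ι) (g : ℕ → ℝ) :
    ∑ c, g (cutSize Y S c) =
      Fintype.card G * ∑ i ∈ Finset.range (S.card + 1), cutProb Y S i * g i := by
  rw [← Finset.sum_fiberwise_of_maps_to (t := Finset.range (S.card + 1)) (g := cutSize Y S)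
    (fun c _ => Finset.mem_range.2 (Nat.lt_succ_of_le (cutSize_le Y S c))), Finset.mul_sum]
  refine Finset.sum_congr rfl fun i _ => ?_
  have : (Fintype.card G : ℝ) ≠ 0 := by exact_mod_cast Fintype.card_ne_zero
  rw [Finset.sum_congr rfl (g := fun _ => g i), Finset.sum_const, nsmul_eq_mul, cutProb]
  · field_simp
  · intro c hc
    rw [(Finset.mem_filter.1 hc).2]

lemma sum_sign_eq [DecidableEq (G →* ℤˣ)] (χ : G →* ℤˣ) :
    ∑ c, ((χ c : ℤ) : ℝ) = if χ = 1 then (Fintype.card G : ℝ) else 0 := by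
  split_ifs with h
  · simp [h]
  · have h' := sum_hom_units_eq_zero ((Units.coeHom ℤ).comp χ) (fun h' => h <| by
      ext c
      simpa using DFunLike.congr_fun h' c)
    have : ((∑ c, (χ c : ℤ) : ℤ) : ℝ) = 0 := by exact_mod_cast h'
    simpa using this

lemma sum_sign_mul_signSum_pow_nonneg (Y : ι → G →* ℤˣ) (S : Finset ι) (j : ℕ) (χ : G →* ℤˣ) :
    0 ≤ ∑ c, ((χ c : ℤ) : ℝ) * signSum Y S c ^ j := by
  classical
  induction j generalizing χ with
  | zero =>
    simp only [pow_zero, mul_one, sum_sign_eq]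
    positivity
  | succ j ih =>
    have : ∀ c, ((χ c : ℤ) : ℝ) * signSum Y S c ^ (j + 1) =
        ∑ e ∈ S, (((χ * Y e) c : ℤ) : ℝ) * signSum Y S c ^ j := by
      intro c
      rw [pow_succ', signSum, Finset.sum_mul, Finset.mul_sum]
      exact Finset.sum_congr rfl fun e _ => by push_cast [MonoidHom.mul_apply]; ring
    simp only [this]
    rw [Finset.sum_comm]
    exact Finset.sum_nonneg fun e _ => ih _

lemma sum_signSum_eq_zero {Y : ι → G →* ℤˣ} {S : Finset ι} (h₁ : ∀ e ∈ S, Y e ≠ 1) :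
    ∑ c, signSum Y S c = 0 := by
  classical
  simp only [signSum]
  rw [Finset.sum_comm]
  exact Finset.sum_eq_zero fun e he => by rw [sum_sign_eq, if_neg (h₁ e he)]

lemma sum_signSum_sq {Y : ι → G →* ℤˣ} {S : Finset ι} (h₂ : Set.InjOn Y S) :
    ∑ c, signSum Y S c ^ 2 = Fintype.card G * S.card := by
  classical
  have : ∀ c, signSum Y S c ^ 2 = ∑ e ∈ S, ∑ f ∈ S, (((Y e * Y f) c : ℤ) : ℝ) := by
    intro c
    simp [signSum, sq, Finset.sum_mul_sum]
  simp only [this]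
  rw [Finset.sum_comm, Finset.sum_congr rfl (g := fun _ => (Fintype.card G : ℝ)),
    Finset.sum_const, nsmul_eq_mul, mul_comm]
  intro e he
  rw [Finset.sum_comm,
    Finset.sum_congr rfl (g := fun f => if f = e then (Fintype.card G : ℝ) else 0)]
  · simp [he]
  · intro f hf
    rw [sum_sign_eq]
    refine if_congr ⟨fun h => h₂ hf he ?_, ?_⟩ rfl rfl
    · ext c
      have := DFunLike.congr_fun h c
      rw [MonoidHom.mul_apply, MonoidHom.one_apply, mul_eq_one_iff_eq_inv,
        Int.units_inv_eq_self] at this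
      rw [this]
    · rintro rfl
      ext c
      simp [Int.units_mul_self]

end CutDistribution

section CutWeight

variable {ι G : Type*} [CommGroup G] [Fintype G]

/-- The weights on cut sizes defining the spectrum. -/
noncomputable def cutSizeWeight (i : ℕ) : ℝ :=
  if i = 0 then 1 else if i = 1 then -5 / 7 else if i = 2 then -1 / 7
    else if i = 3 then 3 / 28 else 0

/-- The expected weight of the cut size at a uniformly random point. -/
noncomputable def cutWeight (Y : ι → G →* ℤˣ) (S : Finset ι) : ℝ :=
  (∑ c, cutSizeWeight (cutSize Y S c)) / Fintype.card G

lemma cutWeight_eq (Y : ι → G →* ℤˣ) (S : Finset ι) :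
    cutWeight Y S =
      ∑ i ∈ Finset.range (S.card + 1), cutProb Y S i * cutSizeWeight i := by
  have : (Fintype.card G : ℝ) ≠ 0 := by exact_mod_cast Fintype.card_ne_zero
  rw [cutWeight, sum_comp_cutSize, mul_div_cancel_left₀ _ this]

lemma sum_cutProb (Y : ι → G →* ℤˣ) (S : Finset ι) :
    ∑ i ∈ Finset.range (S.card + 1), cutProb Y S i = 1 := by
  have : (Fintype.card G : ℝ) ≠ 0 := by exact_mod_cast Fintype.card_ne_zero
  have h := sum_comp_cutSize Y S fun _ => 1
  simp only [Finset.sum_const, Finset.card_univ, nsmul_eq_mul, mul_one] at h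
  exact (mul_left_cancel₀ this (by rw [← h, mul_one])).symm

lemma sum_cutProb_mul_sign (Y : ι → G →* ℤˣ) (S : Finset ι) :
    (∑ i ∈ Finset.range (S.card + 1), cutProb Y S i * (-1) ^ i = 0) ∨
      (∏ e ∈ S, Y e = 1 ∧
        ∑ i ∈ Finset.range (S.card + 1), cutProb Y S i * (-1) ^ i = 1) := by
  classical
  have : (Fintype.card G : ℝ) ≠ 0 := by exact_mod_cast Fintype.card_ne_zero
  have h := sum_comp_cutSize Y S fun i => (-1) ^ i
  have h' := sum_sign_eq (∏ e ∈ S, Y e)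
  simp only [prod_sign_eq, Units.val_pow_eq_pow_val, Units.val_neg, Units.val_one, Int.cast_pow,
    Int.cast_neg, Int.cast_one] at h'
  rw [h'] at h
  split_ifs at h with hS
  · exact Or.inr ⟨hS, (mul_left_cancel₀ this (by rw [← h, mul_one])).symm⟩
  · exact Or.inl ((mul_eq_zero.1 h.symm).resolve_left this)

lemma sum_cutProb_mul_nonneg (Y : ι → G →* ℤˣ) (S : Finset ι) (χ : G →* ℤˣ) (j : ℕ) (s : ℝ)
    (hs : ∀ c, ((χ c : ℤ) : ℝ) = s ^ cutSize Y S c) :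
    0 ≤ ∑ i ∈ Finset.range (S.card + 1),
      cutProb Y S i * (s ^ i * ((S.card : ℝ) - 2 * i) ^ j) := by
  have : (0 : ℝ) < Fintype.card G := by exact_mod_cast Fintype.card_pos
  have h := sum_sign_mul_signSum_pow_nonneg Y S j χ
  simp only [hs, signSum_eq] at h
  rw [sum_comp_cutSize Y S fun i => s ^ i * ((S.card : ℝ) - 2 * i) ^ j] at h
  exact nonneg_of_mul_nonneg_right h this

lemma sum_cutProb_mul_cube_nonneg (Y : ι → G →* ℤˣ) (S : Finset ι) :
    0 ≤ ∑ i ∈ Finset.range (S.card + 1), cutProb Y S i * ((S.card : ℝ) - 2 * i) ^ 3 := by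
  simpa using sum_cutProb_mul_nonneg Y S 1 3 1 (by simp)

lemma sum_cutProb_mul_sign_mul_nonneg (Y : ι → G →* ℤˣ) (S : Finset ι) :
    0 ≤ ∑ i ∈ Finset.range (S.card + 1), cutProb Y S i * ((-1) ^ i * ((S.card : ℝ) - 2 * i)) := by
  simpa using sum_cutProb_mul_nonneg Y S (∏ e ∈ S, Y e) 1 (-1) fun c => by
    rw [prod_sign_eq]; simp

lemma sum_cutProb_mul_linear {Y : ι → G →* ℤˣ} {S : Finset ι} (h₁ : ∀ e ∈ S, Y e ≠ 1) :
    ∑ i ∈ Finset.range (S.card + 1), cutProb Y S i * ((S.card : ℝ) - 2 * i) = 0 := by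
  have : (Fintype.card G : ℝ) ≠ 0 := by exact_mod_cast Fintype.card_ne_zero
  have h := sum_signSum_eq_zero h₁
  simp only [signSum_eq] at h
  rw [sum_comp_cutSize Y S fun i => (S.card : ℝ) - 2 * i] at h
  exact (mul_eq_zero.1 h).resolve_left this

lemma sum_cutProb_mul_sq {Y : ι → G →* ℤˣ} {S : Finset ι} (h₂ : Set.InjOn Y S) :
    ∑ i ∈ Finset.range (S.card + 1), cutProb Y S i * ((S.card : ℝ) - 2 * i) ^ 2 = (S.card : ℝ) := by
  have : (Fintype.card G : ℝ) ≠ 0 := by exact_mod_cast Fintype.card_ne_zero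
  have h := sum_signSum_sq h₂
  simp only [signSum_eq] at h
  rw [sum_comp_cutSize Y S fun i => ((S.card : ℝ) - 2 * i) ^ 2] at h
  exact mul_left_cancel₀ this h

lemma sum_cutProb_mul_add_sq {Y : ι → G →* ℤˣ} {S : Finset ι} (h₁ : ∀ e ∈ S, Y e ≠ 1)
    (h₂ : Set.InjOn Y S) (a s : ℝ) :
    ∑ i ∈ Finset.range (S.card + 1), cutProb Y S i * (a * ((S.card : ℝ) - 2 * i + s) ^ 2) =
      a * (S.card + s ^ 2) := by
  have : ∀ i ∈ Finset.range (S.card + 1),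
      cutProb Y S i * (a * ((S.card : ℝ) - 2 * i + s) ^ 2) =
      a * (cutProb Y S i * ((S.card : ℝ) - 2 * i) ^ 2) +
      2 * a * s * (cutProb Y S i * ((S.card : ℝ) - 2 * i)) + a * s ^ 2 * cutProb Y S i := by
    intro i _; ring
  rw [Finset.sum_congr rfl this, Finset.sum_add_distrib, Finset.sum_add_distrib,
    ← Finset.mul_sum, ← Finset.mul_sum, ← Finset.mul_sum, sum_cutProb_mul_sq h₂,
    sum_cutProb_mul_linear h₁, sum_cutProb]
  ring

lemma cutWeight_lt_of_odd {Y : ι → G →* ℤˣ} {S : Finset ι} (h₁ : ∀ e ∈ S, Y e ≠ 1)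
    (h₂ : Set.InjOn Y S) (hS : 7 ≤ S.card) : cutWeight Y S < 1 / 7 := by
  have hm : (7 : ℝ) ≤ S.card := by exact_mod_cast hS
  set m : ℝ := (S.card : ℝ) with hmdef
  have hle : cutWeight Y S ≤ 1 / (m + 2) ^ 2 * (m + 2 ^ 2) := by
    rw [cutWeight_eq, ← sum_cutProb_mul_add_sq h₁ h₂]
    refine Finset.sum_le_sum fun i _ => mul_le_mul_of_nonneg_left ?_ (cutProb_nonneg Y S i)
    rw [← hmdef, div_mul_eq_mul_div, one_mul, le_div_iff₀ (by positivity)]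
    have hsq : 0 ≤ (m - 2 * i + 2) ^ 2 := sq_nonneg _
    unfold cutSizeWeight
    split_ifs with h0 h1 h2 h3
    · subst h0; norm_num
    · nlinarith
    · nlinarith
    · subst h3; norm_num; nlinarith
    · simpa using hsq
  refine hle.trans_lt ?_
  rw [div_mul_eq_mul_div, one_mul, div_lt_div_iff₀ (by positivity) (by norm_num)]
  nlinarith

lemma neg_one_div_lt_cutWeight {Y : ι → G →* ℤˣ} {S : Finset ι} (h₁ : ∀ e ∈ S, Y e ≠ 1)
    (h₂ : Set.InjOn Y S) (hS : 8 ≤ S.card) : -1 / 7 < cutWeight Y S := by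
  have hm : (8 : ℝ) ≤ S.card := by exact_mod_cast hS
  set m : ℝ := (S.card : ℝ) with hmdef
  have hle : -(5 / (7 * m ^ 2)) * (m + 2 ^ 2) ≤ cutWeight Y S := by
    rw [cutWeight_eq, ← sum_cutProb_mul_add_sq h₁ h₂]
    refine Finset.sum_le_sum fun i _ => mul_le_mul_of_nonneg_left ?_ (cutProb_nonneg Y S i)
    rw [← hmdef, neg_mul, neg_le, div_mul_eq_mul_div, le_div_iff₀ (by positivity)]
    have hsq : 0 ≤ (m - 2 * i + 2) ^ 2 := sq_nonneg _
    unfold cutSizeWeight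
    split_ifs with h0 h1 h2 h3
    · nlinarith
    · subst h1; norm_num; nlinarith
    · subst h2; norm_num; nlinarith
    · nlinarith
    · simpa using hsq
  refine lt_of_lt_of_le ?_ hle
  rw [neg_mul, neg_div, neg_lt_neg_iff, div_mul_eq_mul_div,
    div_lt_div_iff₀ (by positivity) (by norm_num)]
  nlinarith

/-- The value of the spectrum at `S`. -/
noncomputable def spectrumValue (Y : ι → G →* ℤˣ) (S : Finset ι) : ℝ :=
  (-1) ^ S.card * cutWeight Y S

lemma spectrumValue_empty (Y : ι → G →* ℤˣ) : spectrumValue Y ∅ = 1 := by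
  have : (Fintype.card G : ℝ) ≠ 0 := by exact_mod_cast Fintype.card_ne_zero
  simp [spectrumValue, cutWeight, cutSize, cutSizeWeight, this]

/-- The spectrum is at least `-1 / 7`, and only few configurations attain this value. -/
lemma spectrumValue_bound {Y : ι → G →* ℤˣ} {S : Finset ι} (h₁ : ∀ e ∈ S, Y e ≠ 1)
    (h₂ : Set.InjOn Y S) :
    -1 / 7 ≤ spectrumValue Y S ∧ (spectrumValue Y S = -1 / 7 →
      S.card ≤ 2 ∨ (S.card = 3 ∧ ∏ e ∈ S, Y e = 1) ∨
      (S.card = 4 ∧ 0 < cutProb Y S 4 ∧ cutProb Y S 0 < 1 / 8) ∨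
      (S.card = 5 ∧ 0 < cutProb Y S 4 ∧ 1 / 8 ≤ cutProb Y S 0)) := by
  have hq := cutProb_nonneg Y S
  have e₀ := sum_cutProb Y S
  have e₁ := sum_cutProb_mul_linear h₁
  have e₂ := sum_cutProb_mul_sq h₂
  have e₃ := sum_cutProb_mul_cube_nonneg Y S
  have e₄ := sum_cutProb_mul_sign_mul_nonneg Y S
  have e₅ := sum_cutProb_mul_sign Y S
  have w := cutWeight_eq Y S
  rcases lt_or_ge S.card 7 with h7 | h7
  · unfold spectrumValue
    rw [w]
    generalize S.card = m at *
    have := hq 0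
    have := hq 1
    have := hq 2
    have := hq 3
    have := hq 4
    have := hq 5
    have := hq 6
    clear w
    interval_cases m <;> norm_num [Finset.sum_range_succ, cutSizeWeight] at e₀ e₁ e₂ e₃ e₄ e₅ ⊢
    · linarith
    · linarith
    · linarith
    · rcases e₅ with e₅ | ⟨hS, e₅⟩
      · exact ⟨by linarith, fun h => by linarith⟩
      · exact ⟨by linarith, fun _ => hS⟩
    · rcases e₅ with e₅ | ⟨hS, e₅⟩
      · exact ⟨by linarith, fun h => ⟨by linarith, by linarith⟩⟩
      · exact ⟨by linarith, fun h => by linarith⟩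
    · rcases e₅ with e₅ | ⟨hS, e₅⟩
      · exact ⟨by linarith, fun h => ⟨by linarith, by linarith⟩⟩
      · exact ⟨by linarith, fun h => by linarith⟩
    · rcases e₅ with e₅ | ⟨hS, e₅⟩
      · exact ⟨by linarith, fun h => by linarith⟩
      · exact ⟨by linarith, fun h => by linarith⟩
  · rcases Nat.even_or_odd S.card with he | ho
    · have := neg_one_div_lt_cutWeight h₁ h₂
        (by obtain ⟨k, hk⟩ := he; omega)
      rw [spectrumValue, he.neg_one_pow, one_mul]
      exact ⟨this.le, fun h => absurd h this.ne'⟩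
    · have := cutWeight_lt_of_odd h₁ h₂ h7
      rw [spectrumValue, ho.neg_one_pow]
      exact ⟨by linarith, fun h => by linarith⟩

end CutWeight

section Stability

variable {ι G : Type*} [CommGroup G]

/-- No two members of `F` agree only on edges that are cut by some point of `G`. -/
def CutAgreeing (Y : ι → G →* ℤˣ) (E : Finset ι) (F : Finset (Finset ι)) : Prop :=
  ∀ A ∈ F, ∀ B ∈ F, ∀ c, ∃ e ∈ E, (e ∈ A ↔ e ∈ B) ∧ Y e c ≠ -1

/-- The members of `E` cut by `c`. -/
def cutSet (Y : ι → G →* ℤˣ) (E : Finset ι) (c : G) : Finset ι := E.filter fun e => Y e c = -1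

lemma card_inter_cutSet [DecidableEq ι] {Y : ι → G →* ℤˣ} {E S : Finset ι} (hS : S ⊆ E) (c : G) :
    (S ∩ cutSet Y E c).card = cutSize Y S c := by
  rw [cutSet, Finset.inter_filter, Finset.inter_eq_left.2 hS, cutSize]

lemma CutAgreeing.exists_notMem_cutSet {Y : ι → G →* ℤˣ} {E : Finset ι} {F : Finset (Finset ι)}
    (hA : CutAgreeing Y E F) (c : G) :
    ∀ A ∈ F, ∀ B ∈ F, ∃ e ∈ E, (e ∈ A ↔ e ∈ B) ∧ e ∉ cutSet Y E c := by
  intro A hAF B hBF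
  obtain ⟨e, he, hAB, hc⟩ := hA A hAF B hBF c
  exact ⟨e, he, hAB, fun h => hc (Finset.mem_filter.1 h).2⟩

variable [Fintype G]

lemma exists_cutSize_eq_of_cutProb_pos {Y : ι → G →* ℤˣ} {S : Finset ι} {i : ℕ}
    (h : 0 < cutProb Y S i) : ∃ c, cutSize Y S c = i := by
  by_contra! hne
  simp [cutProb, hne] at h

lemma cutProb_zero_anti (Y : ι → G →* ℤˣ) {S T : Finset ι} (h : S ⊆ T) :
    cutProb Y T 0 ≤ cutProb Y S 0 := by
  refine div_le_div_of_nonneg_right (Nat.cast_le.2 (Finset.card_le_card fun c => ?_))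
    (Nat.cast_nonneg _)
  have : cutSize Y S c ≤ cutSize Y T c :=
    Finset.card_le_card (Finset.filter_subset_filter _ h)
  simp only [Finset.mem_filter, Finset.mem_univ, true_and]
  omega

variable [DecidableEq ι] {Y : ι → G →* ℤˣ} {E : Finset ι} {F : Finset (Finset ι)}

lemma sum_spectrumValue_mul_sq_walshCoeff (hA : CutAgreeing Y E F) :
    ∑ S ∈ E.powerset, spectrumValue Y S * walshCoeff F S ^ 2 = 0 := by
  have : ∀ S ∈ E.powerset, spectrumValue Y S * walshCoeff F S ^ 2 =
      (∑ c, (-1 : ℝ) ^ S.card * cutSizeWeight (S ∩ cutSet Y E c).card * walshCoeff F S ^ 2) /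
        Fintype.card G := by
    intro S hS
    simp only [card_inter_cutSet (Finset.mem_powerset.1 hS)]
    rw [← Finset.sum_mul, ← Finset.mul_sum, spectrumValue, cutWeight]
    ring
  rw [Finset.sum_congr rfl this, ← Finset.sum_div, Finset.sum_comm, Finset.sum_eq_zero, zero_div]
  exact fun c _ => sum_neg_one_pow_mul_sq_walshCoeff_eq_zero (hA.exists_notMem_cutSet c) _

lemma sum_spectrumValue_add_mul_sq_walshCoeff (hF : F ⊆ E.powerset) (hA : CutAgreeing Y E F) :
    ∑ S ∈ E.powerset.erase ∅, (spectrumValue Y S + 1 / 7) * walshCoeff F S ^ 2 =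
      (2 ^ E.card * F.card - 8 * (F.card : ℝ) ^ 2) / 7 := by
  have h := Finset.add_sum_erase E.powerset
    (fun S => (spectrumValue Y S + 1 / 7) * walshCoeff F S ^ 2) (Finset.empty_mem_powerset E)
  simp only [add_mul] at h ⊢
  rw [Finset.sum_add_distrib (s := E.powerset), ← Finset.mul_sum, sum_sq_walshCoeff hF,
    sum_spectrumValue_mul_sq_walshCoeff hA, spectrumValue_empty, walshCoeff_empty] at h
  linarith

lemma spectrumValue_add_mul_sq_nonneg (h₁ : ∀ e ∈ E, Y e ≠ 1) (h₂ : Set.InjOn Y E)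
    {S : Finset ι} (hS : S ⊆ E) : 0 ≤ (spectrumValue Y S + 1 / 7) * walshCoeff F S ^ 2 := by
  have := (spectrumValue_bound (fun e he => h₁ e (hS he)) (h₂.mono hS)).1
  exact mul_nonneg (by linarith) (sq_nonneg _)

lemma eight_mul_card_le (h₁ : ∀ e ∈ E, Y e ≠ 1) (h₂ : Set.InjOn Y E) (hF : F ⊆ E.powerset)
    (hA : CutAgreeing Y E F) : 8 * (F.card : ℝ) ≤ 2 ^ E.card := by
  have h := sum_spectrumValue_add_mul_sq_walshCoeff hF hA
  have h' : 0 ≤ ∑ S ∈ E.powerset.erase ∅,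
      (spectrumValue Y S + 1 / 7) * walshCoeff F S ^ 2 :=
    Finset.sum_nonneg fun S hS => spectrumValue_add_mul_sq_nonneg h₁ h₂
      (Finset.mem_powerset.1 (Finset.mem_of_mem_erase hS))
  rcases Nat.eq_zero_or_pos F.card with h0 | h0
  · rw [h0]; norm_num
  · have h0' : (0 : ℝ) < F.card := by exact_mod_cast h0
    rw [h] at h'
    refine le_of_mul_le_mul_right ?_ h0'
    linarith

lemma spectrumValue_eq_of_walshCoeff_ne_zero (h₁ : ∀ e ∈ E, Y e ≠ 1) (h₂ : Set.InjOn Y E)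
    (hF : F ⊆ E.powerset) (hA : CutAgreeing Y E F) (hcard : 8 * (F.card : ℝ) = 2 ^ E.card)
    {S : Finset ι} (hS : S ⊆ E) (hne : S ≠ ∅) (hcoeff : walshCoeff F S ≠ 0) :
    spectrumValue Y S = -1 / 7 := by
  have h := sum_spectrumValue_add_mul_sq_walshCoeff hF hA
  rw [← hcard, sq, ← mul_assoc, sub_self, zero_div, Finset.sum_eq_zero_iff_of_nonneg
    fun S hS => spectrumValue_add_mul_sq_nonneg h₁ h₂
      (Finset.mem_powerset.1 (Finset.mem_of_mem_erase hS))] at h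
  have := (mul_eq_zero.1 (h S (Finset.mem_erase.2 ⟨hne, Finset.mem_powerset.2 hS⟩))).resolve_right
    (pow_ne_zero 2 hcoeff)
  linarith

lemma card_le_two_or_of_walshCoeff_ne_zero (h₁ : ∀ e ∈ E, Y e ≠ 1) (h₂ : Set.InjOn Y E)
    (hF : F ⊆ E.powerset) (hA : CutAgreeing Y E F) (hcard : 8 * (F.card : ℝ) = 2 ^ E.card)
    {S : Finset ι} (hS : S ⊆ E) (hcoeff : walshCoeff F S ≠ 0) :
    S.card ≤ 2 ∨ (S.card = 3 ∧ ∏ e ∈ S, Y e = 1) := by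
  have key : ∀ S ⊆ E, walshCoeff F S ≠ 0 → S.card ≤ 2 ∨ (S.card = 3 ∧ ∏ e ∈ S, Y e = 1) ∨
      (S.card = 4 ∧ 0 < cutProb Y S 4 ∧ cutProb Y S 0 < 1 / 8) ∨
      (S.card = 5 ∧ 0 < cutProb Y S 4 ∧ 1 / 8 ≤ cutProb Y S 0) := by
    intro S hS hcoeff
    rcases eq_or_ne S ∅ with rfl | hne
    · simp
    · exact (spectrumValue_bound (fun e he => h₁ e (hS he)) (h₂.mono hS)).2
        (spectrumValue_eq_of_walshCoeff_ne_zero h₁ h₂ hF hA hcard hS hne hcoeff)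
  have card_ne_four : ∀ S ⊆ E, walshCoeff F S ≠ 0 → S.card ≠ 4 := by
    intro S hS hcoeff h4
    have hSk := key S hS hcoeff
    simp only [h4] at hSk
    norm_num at hSk
    obtain ⟨c, hc⟩ := exists_cutSize_eq_of_cutProb_pos hSk.1
    have hSB : S ∩ cutSet Y E c = S :=
      Finset.eq_of_subset_of_card_le Finset.inter_subset_left (by rw [card_inter_cutSet hS, hc, h4])
    have h := sum_coset_sq_walshCoeff_eq_zero (hA.exists_notMem_cutSet c)
      (Finset.inter_eq_left.1 hSB)
    rw [Finset.sum_eq_single S] at h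
    · simp [hcoeff] at h
    · intro T hT hTS
      rw [Finset.mem_filter, Finset.mem_powerset] at hT
      have hST : S ⊆ T := Finset.inter_eq_right.1 (by rw [← hT.2]; simp)
      by_contra hne
      have hTcoeff : walshCoeff F T ≠ 0 := by
        rintro h0
        simp [h0] at hne
      have hle := Finset.card_le_card hST
      rcases key T hT.1 hTcoeff with h | h | h | h
      · omega
      · omega
      · exact hTS (Finset.eq_of_subset_of_card_le hST (by omega)).symm
      · have := cutProb_zero_anti Y hST
        have := hSk.2
        linarith [h.2.2]
    · exact fun h => (h (Finset.mem_filter.2 ⟨Finset.mem_powerset.2 hS, hSB⟩)).elim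
  rcases key S hS hcoeff with h | h | h | h
  · exact Or.inl h
  · exact Or.inr h
  · exact absurd h.1 (card_ne_four S hS hcoeff)
  · obtain ⟨c, hc⟩ := exists_cutSize_eq_of_cutProb_pos h.2.1
    have h0 := sum_coset_sq_walshCoeff_eq_zero (Q := S ∩ cutSet Y E c)
      (hA.exists_notMem_cutSet c) Finset.inter_subset_right
    rw [Finset.sum_congr rfl (g := fun T => -walshCoeff F T ^ 2), Finset.sum_neg_distrib,
      neg_eq_zero, Finset.sum_eq_zero_iff_of_nonneg fun T _ => sq_nonneg _] at h0
    · exact absurd (h0 S (Finset.mem_filter.2 ⟨Finset.mem_powerset.2 hS, rfl⟩))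
        (pow_ne_zero 2 hcoeff)
    · intro T hT
      rw [Finset.mem_filter, Finset.mem_powerset] at hT
      by_cases hTcoeff : walshCoeff F T = 0
      · simp [hTcoeff]
      · have hle := Finset.card_le_card (Finset.inter_subset_left (s₁ := T) (s₂ := cutSet Y E c))
        rw [hT.2, card_inter_cutSet hS, hc] at hle
        have hT5 : T.card = 5 := by
          have := card_ne_four T hT.1 hTcoeff
          rcases key T hT.1 hTcoeff with h | h | h | h <;> omega
        rw [hT5]
        ring

end Stability

section Junta

variable {ι : Type*} [DecidableEq ι] {E T : Finset ι} {F : Finset (Finset ι)}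

lemma card_filter_inter_eq {S : Finset ι} (hT : T ⊆ E) (hS : S ⊆ T) :
    (E.powerset.filter fun A => A ∩ T = S).card = 2 ^ (E.card - T.card) := by
  rw [← Finset.card_sdiff_of_subset hT, ← Finset.card_powerset]
  refine Finset.card_nbij' (fun A => A \ T) (fun A => A ∪ S) ?_ ?_ ?_ ?_
  · intro A hA
    simp only [Finset.mem_coe, Finset.mem_filter, Finset.mem_powerset] at hA ⊢
    exact Finset.sdiff_subset_sdiff hA.1 subset_rfl
  · intro A hA
    simp only [Finset.mem_coe, Finset.mem_filter, Finset.mem_powerset] at hA ⊢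
    refine ⟨Finset.union_subset (hA.trans Finset.sdiff_subset) (hS.trans hT), ?_⟩
    ext e
    have := @hA e
    have := @hS e
    simp only [Finset.mem_inter, Finset.mem_union, Finset.mem_sdiff] at *
    tauto
  · intro A hA
    simp only [Finset.mem_coe, Finset.mem_filter] at hA
    change A \ T ∪ S = A
    rw [← hA.2, Finset.sdiff_union_inter]
  · intro A hA
    simp only [Finset.mem_coe, Finset.mem_powerset] at hA
    ext e
    have := @hA e
    have := @hS e
    simp only [Finset.mem_union, Finset.mem_sdiff] at *
    tauto

/-- If `U` is the only set with nonzero coefficient whose trace on `T` is `U`, then the local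
coefficient at `U` of `F` around any `A` is a multiple of the character of `U`. -/
lemma sum_walsh_local {U A : Finset ι} (hF : F ⊆ E.powerset) (hT : T ⊆ E) (hU : U ⊆ T)
    (hunique : ∀ S ⊆ E, walshCoeff F S ≠ 0 → S ∩ T = U → S = U) (hA : A ⊆ E) :
    2 ^ E.card * ∑ B ∈ T.powerset, walsh U B * (if symmDiff A B ∈ F then (1 : ℝ) else 0) =
      2 ^ T.card * walshCoeff F U * walsh U A := by
  have h : ∀ B ∈ T.powerset,
      2 ^ E.card * (walsh U B * (if symmDiff A B ∈ F then (1 : ℝ) else 0)) =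
      ∑ S ∈ E.powerset, walshCoeff F S * walsh S A * walsh (symmDiff U S) B := by
    intro B hB
    have hAB : symmDiff A B ⊆ E := by
      rw [Finset.mem_powerset] at hB
      intro e
      have := @hA e
      have := @hB e
      have := @hT e
      simp only [Finset.mem_symmDiff]
      tauto
    have := walsh_inversion hF hAB
    calc _ = walsh U B * (if symmDiff A B ∈ F then (2 : ℝ) ^ E.card else 0) := by
            split_ifs <;> ring
      _ = _ := by
            rw [← this, Finset.mul_sum]
            refine Finset.sum_congr rfl fun S _ => ?_
            rw [walsh_symmDiff_left, walsh_symmDiff_right]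
            ring
  rw [Finset.mul_sum, Finset.sum_congr rfl h, Finset.sum_comm]
  simp only [← Finset.mul_sum, sum_powerset_walsh, symmDiff_inter_eq_empty_iff hU]
  rw [Finset.sum_eq_single U]
  · rw [if_pos (Finset.inter_eq_left.2 hU)]
    ring
  · intro S hS hne
    by_cases h0 : walshCoeff F S = 0
    · simp [h0]
    · rw [if_neg fun h => hne (hunique S (Finset.mem_powerset.1 hS) h0 h), mul_zero]
  · exact fun h => (h (Finset.mem_powerset.2 (hU.trans hT))).elim

lemma exists_symmDiff_mem (hF : F ⊆ E.powerset) (hT : T ⊆ E) (hTcoeff : walshCoeff F T ≠ 0)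
    (hunique : ∀ S ⊆ E, walshCoeff F S ≠ 0 → S ∩ T = T → S = T) {A : Finset ι} (hA : A ⊆ E) :
    ∃ B ⊆ T, symmDiff A B ∈ F := by
  by_contra! h
  have := sum_walsh_local hF hT subset_rfl hunique hA
  rw [Finset.sum_eq_zero fun B hB => by rw [if_neg (h B (Finset.mem_powerset.1 hB)), mul_zero],
    mul_zero, eq_comm, mul_eq_zero] at this
  have hw : walsh T A ≠ 0 := fun h => by simpa [h] using walsh_mul_self T A
  simp [hTcoeff, hw] at this

lemma sum_card_symmDiff_mem (hF : F ⊆ E.powerset) (hT : T ⊆ E) :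
    ∑ A ∈ E.powerset, (T.powerset.filter fun B => symmDiff A B ∈ F).card =
      2 ^ T.card * F.card := by
  simp only [Finset.card_filter]
  rw [Finset.sum_comm, Finset.sum_congr rfl (g := fun _ => F.card), Finset.sum_const,
    Finset.card_powerset, smul_eq_mul]
  intro B hB
  rw [← Finset.card_filter]
  refine Finset.card_nbij' (fun A => symmDiff A B) (fun A => symmDiff A B) ?_ ?_ ?_ ?_
  · intro A hA
    exact (Finset.mem_filter.1 hA).2
  · intro A hA
    have hAE := Finset.mem_powerset.1 (hF hA)
    have hBT := Finset.mem_powerset.1 hB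
    simp only [Finset.mem_coe, Finset.mem_filter, Finset.mem_powerset,
      symmDiff_symmDiff_cancel_right]
    refine ⟨fun e => ?_, hA⟩
    have := @hAE e
    have := @hBT e
    have := @hT e
    simp only [Finset.mem_symmDiff]
    tauto
  · intro A _
    exact symmDiff_symmDiff_cancel_right _ _
  · intro A _
    exact symmDiff_symmDiff_cancel_right _ _

lemma two_pow_le_mul_card (hF : F ⊆ E.powerset) (hT : T ⊆ E) (hTcoeff : walshCoeff F T ≠ 0)
    (hunique : ∀ S ⊆ E, walshCoeff F S ≠ 0 → S ∩ T = T → S = T) :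
    2 ^ E.card ≤ 2 ^ T.card * F.card := by
  rw [← sum_card_symmDiff_mem hF hT, ← Finset.card_powerset, Finset.card_eq_sum_ones]
  refine Finset.sum_le_sum fun A hA => Finset.card_pos.2 ?_
  obtain ⟨B, hB, hAB⟩ := exists_symmDiff_mem hF hT hTcoeff hunique (Finset.mem_powerset.1 hA)
  exact ⟨B, Finset.mem_filter.2 ⟨Finset.mem_powerset.2 hB, hAB⟩⟩

lemma eq_empty_of_symmDiff_mem (hF : F ⊆ E.powerset) (hT : T ⊆ E) (hTcoeff : walshCoeff F T ≠ 0)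
    (hunique : ∀ S ⊆ E, walshCoeff F S ≠ 0 → S ∩ T = T → S = T)
    (hcard : 2 ^ T.card * F.card = 2 ^ E.card) {A B : Finset ι} (hA : A ∈ F) (hB : B ⊆ T)
    (hAB : symmDiff A B ∈ F) : B = ∅ := by
  have hle : ∀ A ∈ E.powerset, 1 ≤ (T.powerset.filter fun B => symmDiff A B ∈ F).card := by
    intro A hA
    obtain ⟨B, hB, hAB⟩ := exists_symmDiff_mem hF hT hTcoeff hunique (Finset.mem_powerset.1 hA)
    exact Finset.card_pos.2 ⟨B, Finset.mem_filter.2 ⟨Finset.mem_powerset.2 hB, hAB⟩⟩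
  have heq := (Finset.sum_eq_sum_iff_of_le hle).1 (by
    rw [sum_card_symmDiff_mem hF hT, hcard, ← Finset.card_eq_sum_ones, Finset.card_powerset])
    A (hF hA)
  refine Finset.card_le_one.1 heq.ge B (Finset.mem_filter.2 ⟨Finset.mem_powerset.2 hB, hAB⟩) ∅
    (Finset.mem_filter.2 ⟨Finset.empty_mem_powerset T, ?_⟩)
  rwa [← Finset.bot_eq_empty, symmDiff_bot]

lemma walsh_eq_walsh_of_mem {U A B : Finset ι} (hF : F ⊆ E.powerset) (hT : T ⊆ E)
    (hTcoeff : walshCoeff F T ≠ 0)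
    (hTunique : ∀ S ⊆ E, walshCoeff F S ≠ 0 → S ∩ T = T → S = T)
    (hcard : 2 ^ T.card * F.card = 2 ^ E.card) (hU : U ⊆ T)
    (hUunique : ∀ S ⊆ E, walshCoeff F S ≠ 0 → S ∩ T = U → S = U) (hA : A ∈ F) (hB : B ∈ F) :
    walsh U A = walsh U B := by
  have key : ∀ A ∈ F, (2 : ℝ) ^ E.card = 2 ^ T.card * walshCoeff F U * walsh U A := by
    intro A hA
    rw [← sum_walsh_local hF hT hU hUunique (Finset.mem_powerset.1 (hF hA)),
      Finset.sum_eq_single ∅]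
    · have : symmDiff A ∅ ∈ F := by rwa [← Finset.bot_eq_empty, symmDiff_bot]
      rw [if_pos this, walsh_comm, walsh_empty_left]
      ring
    · intro B hB hne
      rw [if_neg fun h => hne (eq_empty_of_symmDiff_mem hF hT hTcoeff hTunique hcard hA
        (Finset.mem_powerset.1 hB) h), mul_zero]
    · exact fun h => (h (Finset.empty_mem_powerset T)).elim
  have h := (key A hA).symm.trans (key B hB)
  refine mul_left_cancel₀ (fun h0 => ?_) h
  have := key A hA
  rw [h0, zero_mul] at this
  exact pow_ne_zero _ two_ne_zero this

lemma walsh_singleton_eq_neg_one_iff {e : ι} {A : Finset ι} : walsh {e} A = -1 ↔ e ∈ A := by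
  by_cases h : e ∈ A <;> norm_num [walsh, h]

end Junta

section Extremal

variable {ι G : Type*} [DecidableEq ι] [CommGroup G] [Fintype G]
  {Y : ι → G →* ℤˣ} {E : Finset ι} {F : Finset (Finset ι)}

lemma exists_junta_of_card_eq (h₁ : ∀ e ∈ E, Y e ≠ 1) (h₂ : Set.InjOn Y E)
    (hF : F ⊆ E.powerset) (hA : CutAgreeing Y E F) (hcard : 8 * (F.card : ℝ) = 2 ^ E.card) :
    ∃ T ⊆ E, T.card = 3 ∧ ∏ e ∈ T, Y e = 1 ∧ ∃ S ⊆ T,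
      F = E.powerset.filter fun A => A ∩ T = S := by
  have hsmall : ∀ S ⊆ E, walshCoeff F S ≠ 0 → S.card ≤ 2 ∨ (S.card = 3 ∧ ∏ e ∈ S, Y e = 1) :=
    fun S hS => card_le_two_or_of_walshCoeff_ne_zero h₁ h₂ hF hA hcard hS
  have hcard' : 8 * F.card = 2 ^ E.card := by exact_mod_cast hcard
  have hFpos : 0 < F.card := by
    have : 0 < 2 ^ E.card := by positivity
    omega
  obtain ⟨T, hTmem, hTmax⟩ := Finset.exists_max_image
    (E.powerset.filter fun S => walshCoeff F S ≠ 0) Finset.card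
    ⟨∅, by simp [walshCoeff_empty, (Finset.card_pos.1 hFpos).ne_empty]⟩
  rw [Finset.mem_filter, Finset.mem_powerset] at hTmem
  obtain ⟨hT, hTcoeff⟩ := hTmem
  have hTunique : ∀ S ⊆ E, walshCoeff F S ≠ 0 → S ∩ T = T → S = T := fun S hS hScoeff hST =>
    (Finset.eq_of_subset_of_card_le (Finset.inter_eq_right.1 hST)
      (hTmax S (Finset.mem_filter.2 ⟨Finset.mem_powerset.2 hS, hScoeff⟩))).symm
  have hT3 : T.card = 3 ∧ ∏ e ∈ T, Y e = 1 := by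
    refine (hsmall T hT hTcoeff).resolve_left fun hle => ?_
    have h := two_pow_le_mul_card hF hT hTcoeff hTunique
    have : 2 ^ T.card ≤ 2 ^ 2 := Nat.pow_le_pow_right (by norm_num) hle
    rw [← hcard'] at h
    have := le_of_mul_le_mul_right h hFpos
    omega
  have hTcard : 2 ^ T.card * F.card = 2 ^ E.card := by
    rw [hT3.1, ← hcard']; norm_num
  have hpair : ∀ e ∈ T, ∀ S ⊆ E, walshCoeff F S ≠ 0 → S ∩ T = T.erase e → S = T.erase e := by
    intro e he S hS hScoeff hST
    have hsub : T.erase e ⊆ S := by rw [← hST]; exact Finset.inter_subset_left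
    have hTe : (T.erase e).card = 2 := by rw [Finset.card_erase_of_mem he, hT3.1]
    rcases hsmall S hS hScoeff with h | ⟨h, hprod⟩
    · exact (Finset.eq_of_subset_of_card_le hsub (by omega)).symm
    · obtain ⟨f, hf⟩ := Finset.card_eq_one.1 (by
        rw [Finset.card_sdiff_of_subset hsub, h, hTe] : (S \ T.erase e).card = 1)
      have hfS : f ∈ S := Finset.sdiff_subset (hf ▸ Finset.mem_singleton_self f)
      have hYef : Y e = Y f := by
        have h₃ := Finset.prod_sdiff (f := Y) hsub
        have h₄ := Finset.mul_prod_erase T Y he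
        rw [hf, Finset.prod_singleton, hprod] at h₃
        rw [hT3.2] at h₄
        exact mul_right_cancel (h₄.trans h₃.symm)
      have hef := h₂ (hT he) (hS hfS) hYef
      have : e ∈ S ∩ T := Finset.mem_inter.2 ⟨hef ▸ hfS, he⟩
      simp [hST] at this
  obtain ⟨A₀, hA₀⟩ := Finset.card_pos.1 hFpos
  refine ⟨T, hT, hT3.1, hT3.2, A₀ ∩ T, Finset.inter_subset_right, ?_⟩
  refine Finset.eq_of_subset_of_card_le ?_ ?_
  · intro A hAF
    refine Finset.mem_filter.2 ⟨hF hAF, ?_⟩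
    ext e
    simp only [Finset.mem_inter, and_congr_left_iff]
    intro he
    have hsing : walsh {e} A = walsh {e} A₀ := by
      have : symmDiff T (T.erase e) = {e} := by
        ext f
        by_cases hfe : f = e <;> simp [Finset.mem_symmDiff, hfe, he]
      rw [← this, walsh_symmDiff_left, walsh_symmDiff_left,
        walsh_eq_walsh_of_mem hF hT hTcoeff hTunique hTcard subset_rfl hTunique hAF hA₀,
        walsh_eq_walsh_of_mem hF hT hTcoeff hTunique hTcard (Finset.erase_subset e T)
          (hpair e he) hAF hA₀]
    rw [← walsh_singleton_eq_neg_one_iff, hsing, walsh_singleton_eq_neg_one_iff]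
  · rw [card_filter_inter_eq hT Finset.inter_subset_right]
    refine le_of_eq (Nat.eq_of_mul_eq_mul_left (pow_pos two_pos T.card) ?_)
    rw [hTcard, ← pow_add, Nat.add_sub_cancel' (Finset.card_le_card hT)]

end Extremal

section Graph

variable {V : Type*}

/-- The product of the signs of the two endpoints of `e`. -/
def edgeSign (e : Sym2 V) : (V → ℤˣ) →* ℤˣ :=
  Sym2.lift ⟨fun a b => Pi.evalMonoidHom (fun _ => ℤˣ) a * Pi.evalMonoidHom (fun _ => ℤˣ) b,
    fun _ _ => mul_comm _ _⟩ e

lemma edgeSign_mk (a b : V) (c : V → ℤˣ) : edgeSign s(a, b) c = c a * c b := rfl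

lemma edgeSign_mulSingle [DecidableEq V] {e : Sym2 V} (he : ¬ e.IsDiag) (v : V) :
    edgeSign e (Pi.mulSingle v (-1)) = if v ∈ e then -1 else 1 := by
  induction e with
  | _ a b =>
    rw [Sym2.mk_isDiag_iff] at he
    rw [edgeSign_mk]
    simp only [Pi.mulSingle_apply, Sym2.mem_iff]
    by_cases ha : a = v
    · subst ha
      simp [Ne.symm he]
    · by_cases hb : b = v
      · subst hb
        simp [he]
      · simp [ha, hb, Ne.symm ha, Ne.symm hb]

lemma edgeSign_ne_one {e : Sym2 V} (he : ¬ e.IsDiag) : edgeSign e ≠ 1 := by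
  classical
  intro h
  have hv := edgeSign_mulSingle he e.out.1
  rw [h, MonoidHom.one_apply, if_pos (Sym2.out_fst_mem e)] at hv
  exact absurd hv (by decide)

lemma eq_of_edgeSign_eq {e f : Sym2 V} (he : ¬ e.IsDiag) (hf : ¬ f.IsDiag)
    (h : edgeSign e = edgeSign f) : e = f := by
  classical
  refine Sym2.ext fun v => ?_
  have h' := edgeSign_mulSingle he v
  rw [h, edgeSign_mulSingle hf v] at h'
  split_ifs at h' with h₁ h₂ h₂
  · exact iff_of_true h₂ h₁
  · exact absurd h' (by decide)
  · exact absurd h' (by decide)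
  · exact iff_of_false h₂ h₁

lemma sign_eq_of_walk {G : SimpleGraph V} {c : V → ℤˣ} (hc : ∀ a b, G.Adj a b → c a * c b = -1)
    {u v : V} (w : G.Walk u v) : c u * c v = (-1) ^ w.length := by
  induction w with
  | nil => simp [Int.units_mul_self]
  | @cons a b d h p ih =>
    calc c a * c d = (c a * c b) * (c b * c d) := by
          rw [mul_assoc, ← mul_assoc (c b), Int.units_mul_self, one_mul]
      _ = _ := by rw [hc a b h, ih, SimpleGraph.Walk.length_cons, pow_succ']

lemma HasOddCycle.exists_edgeSign_ne {n : ℕ} {A : Finset (Sym2 (Fin n))} (hA : HasOddCycle A)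
    (c : Fin n → ℤˣ) : ∃ e ∈ A, edgeSign e c ≠ -1 := by
  obtain ⟨v, w, -, hw⟩ := hA
  by_contra! h
  have h' := sign_eq_of_walk (G := graphOf A) (c := c) (fun a b hab => h s(a, b) (by
    simpa using ((SimpleGraph.fromEdgeSet_adj _).1 hab).1)) w
  rw [Int.units_mul_self, hw.neg_one_pow] at h'
  exact absurd h' (by decide)

lemma mem_edgeFinset_iff {n : ℕ} {e : Sym2 (Fin n)} : e ∈ edgeFinset n ↔ ¬ e.IsDiag := by
  simp [edgeFinset]

lemma card_edgeFinset (n : ℕ) : (edgeFinset n).card = n.choose 2 := by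
  rw [edgeFinset, ← Fintype.card_subtype, Sym2.card_subtype_not_diag, Fintype.card_fin]

lemma OddCycleAgreeing.cutAgreeing {n : ℕ} {F : Finset (Finset (Sym2 (Fin n)))}
    (hF : OddCycleAgreeing n F) : CutAgreeing edgeSign (edgeFinset n) F := by
  intro A hA B hB c
  obtain ⟨e, he, hc⟩ := (hF A hA B hB).exists_edgeSign_ne c
  simp only [Finset.mem_sdiff, Finset.mem_union] at he
  exact ⟨e, he.1, by tauto, hc⟩

lemma IsTriangle.subset_edgeFinset {n : ℕ} {T : Finset (Sym2 (Fin n))} (hT : IsTriangle T) :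
    T ⊆ edgeFinset n := by
  obtain ⟨a, b, c, hab, hac, hbc, rfl⟩ := hT
  intro e he
  rw [mem_edgeFinset_iff]
  simp only [Finset.mem_insert, Finset.mem_singleton] at he
  rcases he with rfl | rfl | rfl <;> simpa

lemma IsTriangle.card_eq {n : ℕ} {T : Finset (Sym2 (Fin n))} (hT : IsTriangle T) :
    T.card = 3 := by
  obtain ⟨a, b, c, hab, hac, hbc, rfl⟩ := hT
  refine Finset.card_eq_three.2 ⟨_, _, _, ?_, ?_, ?_, rfl⟩ <;>
    simp [hab, hac, hbc, hab.symm]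

lemma isTriangle_of_prod_edgeSign_eq_one {n : ℕ} {T : Finset (Sym2 (Fin n))}
    (hT : T ⊆ edgeFinset n) (hcard : T.card = 3) (hprod : ∏ e ∈ T, edgeSign e = 1) :
    IsTriangle T := by
  have aux : ∀ e f g : Sym2 (Fin n), ¬ e.IsDiag → ¬ f.IsDiag → e ≠ f →
      (∀ v, v ∈ e → v ∉ f → v ∈ g) → (∀ v, v ∉ e → v ∈ f → v ∈ g) → ∀ a, a ∈ e → a ∈ f →
      IsTriangle {e, f, g} := by
    intro e f g he hf hef h₁ h₂ a hae haf
    obtain ⟨b, rfl⟩ := hae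
    obtain ⟨d, rfl⟩ := haf
    rw [Sym2.mk_isDiag_iff] at he hf
    have hbd : b ≠ d := fun h => hef (by rw [h])
    have hb : b ∈ g := h₁ b (by simp) (by simp [Ne.symm he, hbd])
    have hd : d ∈ g := h₂ d (by simp [Ne.symm hf, hbd.symm]) (by simp)
    exact ⟨a, b, d, he, hf, hbd, by rw [(Sym2.mem_and_mem_iff hbd).1 ⟨hb, hd⟩]⟩
  obtain ⟨e, f, g, hef, heg, hfg, rfl⟩ := Finset.card_eq_three.1 hcard
  have he := mem_edgeFinset_iff.1 (hT (by simp : e ∈ ({e, f, g} : Finset _)))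
  have hf := mem_edgeFinset_iff.1 (hT (by simp : f ∈ ({e, f, g} : Finset _)))
  have hg := mem_edgeFinset_iff.1 (hT (by simp : g ∈ ({e, f, g} : Finset _)))
  rw [Finset.prod_insert (by simp [hef, heg]), Finset.prod_pair hfg] at hprod
  have hpar : ∀ v, (if v ∈ e then (-1 : ℤˣ) else 1) *
      ((if v ∈ f then -1 else 1) * (if v ∈ g then -1 else 1)) = 1 := by
    intro v
    have h := DFunLike.congr_fun hprod (Pi.mulSingle v (-1))
    rwa [MonoidHom.mul_apply, MonoidHom.mul_apply, edgeSign_mulSingle he, edgeSign_mulSingle hf,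
      edgeSign_mulSingle hg] at h
  have heven : ∀ v, v ∈ e ∧ v ∈ f ∧ v ∉ g ∨ v ∈ e ∧ v ∉ f ∧ v ∈ g ∨ v ∉ e ∧ v ∈ f ∧ v ∈ g ∨
      v ∉ e ∧ v ∉ f ∧ v ∉ g := by
    intro v
    have h := hpar v
    by_cases h₁ : v ∈ e <;> by_cases h₂ : v ∈ f <;> by_cases h₃ : v ∈ g <;>
      simp [h₁, h₂, h₃] at h ⊢
  have hout := Sym2.out_fst_mem e
  rcases heven e.out.1 with h | h | h | h
  · exact aux e f g he hf hef (fun v => by have := heven v; tauto)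
      (fun v => by have := heven v; tauto) _ hout h.2.1
  · rw [Finset.pair_comm f g]
    exact aux e g f he hg heg (fun v => by have := heven v; tauto)
      (fun v => by have := heven v; tauto) _ hout h.2.2
  · exact absurd hout h.1
  · exact absurd hout h.1

end Graph

theorem odd_cycle_agreeing_card_bound
    (n : ℕ) (hn : 3 ≤ n)
    (F : Finset (Finset (Sym2 (Fin n))))
    (hF : F ⊆ (edgeFinset n).powerset)
    (hAgr : OddCycleAgreeing n F) :
    (F.card : ℝ) ≤ (1 / 8) * 2 ^ (n.choose 2) ∧
      ((F.card : ℝ) = (1 / 8) * 2 ^ (n.choose 2) ↔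
        ∃ T S : Finset (Sym2 (Fin n)), IsTriangle T ∧ S ⊆ T ∧
          F = (edgeFinset n).powerset.filter (fun G => G ∩ T = S)) := by
  have h₁ : ∀ e ∈ edgeFinset n, edgeSign e ≠ 1 := fun e he =>
    edgeSign_ne_one (mem_edgeFinset_iff.1 he)
  have h₂ : Set.InjOn edgeSign (edgeFinset n : Set (Sym2 (Fin n))) := fun e he f hf h =>
    eq_of_edgeSign_eq (mem_edgeFinset_iff.1 he) (mem_edgeFinset_iff.1 hf) h
  rw [← card_edgeFinset]
  refine ⟨?_, fun h => ?_, ?_⟩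
  · linarith [eight_mul_card_le h₁ h₂ hF hAgr.cutAgreeing]
  · obtain ⟨T, hT, hT3, hprod, S, hS, hFS⟩ :=
      exists_junta_of_card_eq h₁ h₂ hF hAgr.cutAgreeing (by linarith)
    exact ⟨T, S, isTriangle_of_prod_edgeSign_eq_one hT hT3 hprod, hS, hFS⟩
  · rintro ⟨T, S, hT, hS, rfl⟩
    have hle := Finset.card_le_card hT.subset_edgeFinset
    rw [hT.card_eq] at hle
    rw [card_filter_inter_eq hT.subset_edgeFinset hS, hT.card_eq, Nat.cast_pow, Nat.cast_ofNat]
    obtain ⟨k, hk⟩ := Nat.exists_eq_add_of_le hle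
    rw [hk, Nat.add_sub_cancel_left, pow_add]
    ring
end

section
/- There exists an absolute constant c > 0 such that for every n ≥ 3, every ε ≥ 0, and every odd-cycle-agreeing family F of subgraphs of K_n with μ(F) ≥ 1/8 − ε, there is a triangle junta T (a family of the form {G ⊆ E_n : G ∩ T = S} for a fixed triangle T and fixed S ⊆ T) such that μ(F Δ T) ≤ c·ε, where F Δ T denotes the symmetric difference of the two families. -/
/-- The uniform measure of a family of subgraphs of `K_n`. -/
noncomputable def muFam (n : ℕ) (F : Finset (Finset (Sym2 (Fin n)))) : ℝ :=
  (F.card : ℝ) / 2 ^ (n.choose 2)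

namespace CubeFourier

open Finset
open scoped symmDiff

variable {α : Type*} [Fintype α]

/-- The average of a function over the cube of all subsets of `α`. -/
noncomputable def mean (f : Finset α → ℝ) : ℝ :=
  (∑ x, f x) / 2 ^ Fintype.card α

lemma mean_add (f g : Finset α → ℝ) : mean (fun x => f x + g x) = mean f + mean g := by
  simp [mean, sum_add_distrib, add_div]

lemma mean_sub (f g : Finset α → ℝ) : mean (fun x => f x - g x) = mean f - mean g := by
  simp [mean, sum_sub_distrib, sub_div]

lemma mean_const_mul (c : ℝ) (f : Finset α → ℝ) : mean (fun x => c * f x) = c * mean f := by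
  simp [mean, ← mul_sum, mul_div_assoc]

lemma mean_const (c : ℝ) : mean (fun _ : Finset α => c) = c := by
  simp [mean]

lemma mean_sum {ι : Type*} (s : Finset ι) (f : ι → Finset α → ℝ) :
    mean (fun x => ∑ i ∈ s, f i x) = ∑ i ∈ s, mean (f i) := by
  simp only [mean]
  rw [sum_comm, sum_div]

lemma mean_mono {f g : Finset α → ℝ} (h : ∀ x, f x ≤ g x) : mean f ≤ mean g := by
  unfold mean
  gcongr
  exact h _

lemma mean_nonneg {f : Finset α → ℝ} (h : ∀ x, 0 ≤ f x) : 0 ≤ mean f := by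
  unfold mean
  exact div_nonneg (sum_nonneg fun x _ => h x) (by positivity)

lemma mean_mul_sq_le (f g : Finset α → ℝ) :
    mean (fun x => f x * g x) ^ 2 ≤ mean (fun x => f x ^ 2) * mean fun x => g x ^ 2 := by
  unfold mean
  rw [div_pow, div_mul_div_comm, ← sq]
  gcongr
  exact sum_mul_sq_le_sq_mul_sq _ _ _

variable [DecidableEq α]

/-- The character of the cube indexed by `R`. -/
def chi (R x : Finset α) : ℝ :=
  ∏ e, if e ∈ R ∧ e ∈ x then -1 else 1

/-- The Fourier coefficients of a function on the cube. -/
noncomputable def hat (f : Finset α → ℝ) (R : Finset α) : ℝ :=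
  mean fun x => f x * chi R x

lemma mean_comp_symmDiff (f : Finset α → ℝ) (y : Finset α) :
    mean (fun x => f (x ∆ y)) = mean f := by
  unfold mean
  congr 1
  exact Equiv.sum_comp (Function.Involutive.toPerm (fun x : Finset α => x ∆ y)
    fun x => symmDiff_symmDiff_cancel_right y x) f

lemma chi_comm (R x : Finset α) : chi R x = chi x R := by
  simp only [chi, and_comm]

lemma chi_symmDiff (R x y : Finset α) : chi R (x ∆ y) = chi R x * chi R y := by
  unfold chi
  rw [← prod_mul_distrib]
  refine prod_congr rfl fun e _ => ?_
  by_cases h1 : e ∈ R <;> by_cases h2 : e ∈ x <;> by_cases h3 : e ∈ y <;>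
    simp [h1, h2, h3, mem_symmDiff]

lemma symmDiff_chi (R S x : Finset α) : chi (R ∆ S) x = chi R x * chi S x := by
  rw [chi_comm, chi_symmDiff, chi_comm x R, chi_comm x S]

lemma chi_singleton (i : α) (x : Finset α) : chi {i} x = if i ∈ x then -1 else 1 := by
  unfold chi
  rw [prod_eq_single i]
  · simp
  · intro e _ he
    simp [he]
  · simp

lemma chi_singleton_right (R : Finset α) (i : α) :
    chi R {i} = if i ∈ R then -1 else 1 := by
  rw [chi_comm, chi_singleton]

lemma chi_empty (x : Finset α) : chi ∅ x = 1 := by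
  simp [chi]

lemma chi_mul_self (R x : Finset α) : chi R x * chi R x = 1 := by
  rw [← symmDiff_chi, symmDiff_self, bot_eq_empty, chi_empty]

lemma mean_chi (R : Finset α) : mean (chi R) = if R = ∅ then 1 else 0 := by
  split_ifs with h
  · simp [h, mean, chi_empty]
  · obtain ⟨i, hi⟩ := nonempty_iff_ne_empty.2 h
    have h1 := mean_comp_symmDiff (chi R) {i}
    simp only [chi_symmDiff, chi_singleton_right, hi, if_true] at h1
    have h2 := mean_const_mul (-1) (chi R)
    simp only [mul_comm (-1 : ℝ)] at h2
    linarith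

lemma symmDiff_eq_empty_iff (R S : Finset α) : R ∆ S = ∅ ↔ R = S := by
  rw [← bot_eq_empty, symmDiff_eq_bot]

lemma hat_chi (R S : Finset α) : hat (chi R) S = if R = S then 1 else 0 := by
  have h : hat (chi R) S = mean (chi (R ∆ S)) := by
    unfold hat
    congr 1
    ext x
    rw [symmDiff_chi]
  rw [h, mean_chi, if_congr (symmDiff_eq_empty_iff R S) rfl rfl]

lemma hat_add (f g : Finset α → ℝ) (R : Finset α) :
    hat (fun x => f x + g x) R = hat f R + hat g R := by
  simp only [hat, add_mul, mean_add]

lemma hat_sub (f g : Finset α → ℝ) (R : Finset α) :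
    hat (fun x => f x - g x) R = hat f R - hat g R := by
  simp only [hat, sub_mul, mean_sub]

lemma hat_const_mul (c : ℝ) (f : Finset α → ℝ) (R : Finset α) :
    hat (fun x => c * f x) R = c * hat f R := by
  simp only [hat, mul_assoc, mean_const_mul]

lemma hat_sum {ι : Type*} (s : Finset ι) (f : ι → Finset α → ℝ) (R : Finset α) :
    hat (fun x => ∑ i ∈ s, f i x) R = ∑ i ∈ s, hat (f i) R := by
  simp only [hat, sum_mul, mean_sum]

lemma sum_hat_mul_chi (f : Finset α → ℝ) (x : Finset α) :
    ∑ R, hat f R * chi R x = f x := by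
  have key : ∀ y : Finset α, ∑ R, chi R y * chi R x =
      if y = x then (2 : ℝ) ^ Fintype.card α else 0 := by
    intro y
    have h := mean_chi (y ∆ x)
    rw [if_congr (symmDiff_eq_empty_iff y x) rfl rfl, mean,
      div_eq_iff (by positivity : (2 : ℝ) ^ Fintype.card α ≠ 0)] at h
    calc ∑ R, chi R y * chi R x = ∑ R, chi (y ∆ x) R :=
          sum_congr rfl fun R _ => by rw [← chi_symmDiff, chi_comm]
      _ = _ := by rw [h]; split_ifs <;> simp
  simp only [hat, mean, div_mul_eq_mul_div, sum_mul]
  rw [← sum_div, sum_comm]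
  simp only [mul_assoc, ← mul_sum, key]
  simp

lemma hat_sum_mul_chi (c : Finset α → ℝ) (S : Finset α) :
    hat (fun x => ∑ R, c R * chi R x) S = c S := by
  rw [hat_sum]
  simp [hat_const_mul, hat_chi]

lemma mean_mul (f g : Finset α → ℝ) :
    mean (fun x => f x * g x) = ∑ R, hat f R * hat g R := by
  have h : ∀ x, f x * g x = ∑ R, hat f R * (g x * chi R x) := fun x => by
    rw [← sum_hat_mul_chi f x, sum_mul]
    exact sum_congr rfl fun R _ => by ring
  simp only [h, mean_sum, mean_const_mul]
  rfl

lemma mean_sq (f : Finset α → ℝ) : mean (fun x => f x ^ 2) = ∑ R, hat f R ^ 2 := by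
  simp only [sq, mean_mul]

lemma hat_empty (f : Finset α → ℝ) : hat f ∅ = mean f := by
  simp [hat, chi_empty]

lemma hat_mul (f g : Finset α → ℝ) (S : Finset α) :
    hat (fun x => f x * g x) S = ∑ R, hat f R * hat g (R ∆ S) := by
  have h : hat (fun x => f x * g x) S = mean fun x => f x * (g x * chi S x) := by
    simp only [hat, mul_assoc]
  rw [h, mean_mul]
  refine sum_congr rfl fun R _ => ?_
  congr 1
  simp only [hat, symmDiff_chi]
  congr 1
  ext x
  ring

/-- The Fourier expansion of `f` only involves sets with at most `d` elements. -/
def DegreeLE (f : Finset α → ℝ) (d : ℕ) : Prop :=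
  ∀ R, d < #R → hat f R = 0

lemma DegreeLE.mono {f : Finset α → ℝ} {d k : ℕ} (h : DegreeLE f d) (hk : d ≤ k) :
    DegreeLE f k :=
  fun R hR => h R (hk.trans_lt hR)

lemma DegreeLE.sub {f g : Finset α → ℝ} {d : ℕ} (hf : DegreeLE f d) (hg : DegreeLE g d) :
    DegreeLE (fun x => f x - g x) d := fun R hR => by
  rw [hat_sub, hf R hR, hg R hR, sub_zero]

lemma DegreeLE.mul {f g : Finset α → ℝ} {d k : ℕ} (hf : DegreeLE f d) (hg : DegreeLE g k) :
    DegreeLE (fun x => f x * g x) (d + k) := fun S hS => by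
  rw [hat_mul]
  refine sum_eq_zero fun R _ => ?_
  by_cases h : d < #R
  · rw [hf R h, zero_mul]
  · rw [hg (R ∆ S), mul_zero]
    have h1 : S ⊆ R ∪ R ∆ S := fun e he => by
      by_cases heR : e ∈ R <;> simp [mem_symmDiff, he, heR]
    have h2 := (card_le_card h1).trans (card_union_le _ _)
    omega

/-- The part of `f` that changes sign when coordinate `i` is flipped. -/
noncomputable def oddPart (i : α) (f : Finset α → ℝ) (x : Finset α) : ℝ :=
  (f x - f (x ∆ {i})) / 2

/-- The part of `f` that does not depend on coordinate `i`. -/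
noncomputable def evenPart (i : α) (f : Finset α → ℝ) (x : Finset α) : ℝ :=
  (f x + f (x ∆ {i})) / 2

lemma hat_comp_symmDiff (f : Finset α → ℝ) (y R : Finset α) :
    hat (fun x => f (x ∆ y)) R = chi R y * hat f R := by
  have h := mean_comp_symmDiff (fun x => f (x ∆ y) * chi R x) y
  simp only [symmDiff_symmDiff_cancel_right, chi_symmDiff] at h
  rw [hat, ← h, hat, ← mean_const_mul]
  congr 1
  ext x
  ring

lemma hat_oddPart (i : α) (f : Finset α → ℝ) (R : Finset α) :
    hat (oddPart i f) R = if i ∈ R then hat f R else 0 := by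
  have h : oddPart i f = fun x => (1 / 2) * (f x - f (x ∆ {i})) := by
    ext x; simp only [oddPart]; ring
  rw [h, hat_const_mul, hat_sub, hat_comp_symmDiff, chi_singleton_right]
  split_ifs <;> ring

lemma hat_evenPart (i : α) (f : Finset α → ℝ) (R : Finset α) :
    hat (evenPart i f) R = if i ∈ R then 0 else hat f R := by
  have h : evenPart i f = fun x => (1 / 2) * (f x + f (x ∆ {i})) := by
    ext x; simp only [evenPart]; ring
  rw [h, hat_const_mul, hat_add, hat_comp_symmDiff, chi_singleton_right]
  split_ifs <;> ring

lemma DegreeLE.oddPart {f : Finset α → ℝ} {d : ℕ} (h : DegreeLE f d) (i : α) :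
    DegreeLE (oddPart i f) d := fun R hR => by
  rw [hat_oddPart, h R hR, ite_self]

lemma mean_pow_four_eq (i : α) (f : Finset α → ℝ) :
    mean (fun x => f x ^ 4) = mean (fun x => evenPart i f x ^ 4) +
      6 * mean (fun x => evenPart i f x ^ 2 * oddPart i f x ^ 2) +
      mean (fun x => oddPart i f x ^ 4) := by
  have h := mean_comp_symmDiff (fun x => f x ^ 4) {i}
  have h2 : mean (fun x => f x ^ 4) =
      mean fun x => (1 / 2) * (f x ^ 4 + f (x ∆ {i}) ^ 4) := by
    rw [mean_const_mul, mean_add, h]; ring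
  rw [h2, ← mean_const_mul, ← mean_add, ← mean_add]
  congr 1
  ext x
  simp only [evenPart, oddPart]
  ring

/-- Bonami's lemma: the fourth moment of a low-degree function is controlled by its second
moment. -/
theorem mean_pow_four_le_of_support (s : Finset α) :
    ∀ (d : ℕ) (f : Finset α → ℝ), (∀ R, hat f R ≠ 0 → R ⊆ s ∧ #R ≤ d) →
      mean (fun x => f x ^ 4) ≤ 9 ^ d * mean (fun x => f x ^ 2) ^ 2 := by
  induction s using Finset.induction_on with
  | empty =>
    intro d f hf
    have hfx : ∀ x, f x = hat f ∅ := fun x => by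
      rw [← sum_hat_mul_chi f x, sum_eq_single ∅]
      · simp [chi_empty]
      · intro R _ hR
        by_contra hne
        exact hR (subset_empty.1 (hf R (left_ne_zero_of_mul hne)).1)
      · simp
    simp only [hfx, mean_const]
    have h9 : (1 : ℝ) ≤ 9 ^ d := one_le_pow₀ (by norm_num)
    nlinarith [mul_le_mul_of_nonneg_right h9 (by positivity : 0 ≤ hat f ∅ ^ 4)]
  | insert i s hi ih =>
    intro d f hf
    set A := evenPart i f with hA
    set D := oddPart i f with hD
    set b : Finset α → ℝ := fun x => chi {i} x * D x with hb
    have hbsq : ∀ x, b x ^ 2 = D x ^ 2 := fun x => by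
      simp only [hb, mul_pow]; rw [sq (chi _ _), chi_mul_self, one_mul]
    have hb4 : ∀ x, b x ^ 4 = D x ^ 4 := fun x => by
      rw [show 4 = 2 * 2 by norm_num, pow_mul, hbsq, pow_mul]
    have hbhat : ∀ R, hat b R = hat D ({i} ∆ R) := fun R => by
      rw [hb, hat_mul, sum_eq_single {i}]
      · simp [hat_chi]
      · intro S _ hS
        rw [hat_chi, if_neg (Ne.symm hS), zero_mul]
      · simp
    have h2 : mean (fun x => f x ^ 2) = mean (fun x => A x ^ 2) + mean fun x => D x ^ 2 := by
      simp only [mean_sq, ← sum_add_distrib, hA, hD, hat_evenPart, hat_oddPart]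
      exact sum_congr rfl fun R _ => by split_ifs <;> ring
    have hA4 := ih d A fun R hR => by
      rw [hA, hat_evenPart] at hR
      split_ifs at hR with h
      · exact absurd rfl hR
      · exact ⟨(subset_insert_iff_of_notMem h).1 (hf R hR).1, (hf R hR).2⟩
    have h4 := mean_pow_four_eq i f
    rw [← hA, ← hD] at h4
    have hA2 : 0 ≤ mean fun x => A x ^ 2 := mean_nonneg fun x => by positivity
    have hD2 : 0 ≤ mean fun x => D x ^ 2 := mean_nonneg fun x => by positivity
    have hbsupp : ∀ R, hat b R ≠ 0 → R ⊆ s ∧ #R + 1 ≤ d := fun R hR => by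
      rw [hbhat, hD, hat_oddPart] at hR
      split_ifs at hR with h
      · have hiR : i ∉ R := by simpa [mem_symmDiff] using h
        have hins : {i} ∆ R = insert i R := by
          ext e; by_cases he : e = i
          · subst he; simp [mem_symmDiff, hiR]
          · simp [mem_symmDiff, he]
        rw [hins] at hR
        have := hf _ hR
        rw [card_insert_of_notMem hiR] at this
        refine ⟨fun e he => ?_, this.2⟩
        rcases mem_insert.1 (this.1 (mem_insert_of_mem he)) with rfl | h'
        · exact absurd he hiR
        · exact h'
      · exact absurd rfl hR
    rcases Nat.eq_zero_or_pos d with rfl | hd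
    · have hb0 : ∀ x, D x = 0 := fun x => by
        have : b x = 0 := by
          rw [← sum_hat_mul_chi b x]
          refine sum_eq_zero fun R _ => ?_
          by_cases h : hat b R = 0
          · rw [h, zero_mul]
          · have := (hbsupp R h).2
            omega
        have h := hbsq x
        rw [this] at h
        exact pow_eq_zero_iff (two_ne_zero) |>.1 (by linarith)
      rw [h4, h2]
      simp only [hb0]
      norm_num [mean_const]
      simpa using hA4
    · obtain ⟨k, rfl⟩ : ∃ k, d = k + 1 := ⟨d - 1, by omega⟩
      have hD4 := ih k b fun R hR => ⟨(hbsupp R hR).1, by have := (hbsupp R hR).2; omega⟩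
      simp only [hbsq, hb4] at hD4
      have hAD := mean_mul_sq_le (fun x => A x ^ 2) fun x => D x ^ 2
      simp only [← pow_mul] at hAD
      norm_num at hAD
      have hADle : mean (fun x => A x ^ 2 * D x ^ 2) ≤
          3 * 9 ^ k * (mean (fun x => A x ^ 2) * mean fun x => D x ^ 2) := by
        refine abs_le_of_sq_le_sq' (hAD.trans ((mul_le_mul hA4 hD4
          (mean_nonneg fun x => by positivity) (by positivity)).trans_eq ?_))
          (by positivity) |>.2
        ring
      rw [h4, h2]
      set P := mean fun x => A x ^ 2
      set Q := mean fun x => D x ^ 2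
      have h9 : (0 : ℝ) < 9 ^ k := by positivity
      rw [pow_succ] at hA4 ⊢
      nlinarith [mul_nonneg h9.le (sq_nonneg Q)]

theorem DegreeLE.mean_pow_four_le {f : Finset α → ℝ} {d : ℕ} (hf : DegreeLE f d) :
    mean (fun x => f x ^ 4) ≤ 9 ^ d * mean (fun x => f x ^ 2) ^ 2 :=
  mean_pow_four_le_of_support univ d f fun R hR =>
    ⟨subset_univ R, not_lt.1 fun h => hR (hf R h)⟩

end CubeFourier

namespace CubeFourier

open Finset
open scoped symmDiff

variable {α : Type*} [Fintype α] [DecidableEq α]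

/-- The total squared Fourier mass on the coefficients indexed by `R` with `p R`. -/
noncomputable def weight (f : Finset α → ℝ) (p : Finset α → Prop) [DecidablePred p] : ℝ :=
  ∑ R with p R, hat f R ^ 2

lemma DegreeLE.mean_sq_le_mean_abs {f : Finset α → ℝ} {d : ℕ} (hf : DegreeLE f d) :
    mean (fun x => f x ^ 2) ≤ 9 ^ d * mean (fun x => |f x|) ^ 2 := by
  have h4 := hf.mean_pow_four_le
  have h1 := mean_mul_sq_le (fun x => √|f x|) fun x => √|f x| * |f x|
  have h2 := mean_mul_sq_le (fun x => |f x|) fun x => f x ^ 2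
  have e1 : ∀ x, √|f x| * (√|f x| * |f x|) = f x ^ 2 := fun x => by
    rw [← mul_assoc, Real.mul_self_sqrt (abs_nonneg _), abs_mul_abs_self, sq]
  have e2 : ∀ x, (√|f x| * |f x|) ^ 2 = |f x| * f x ^ 2 := fun x => by
    rw [mul_pow, Real.sq_sqrt (abs_nonneg _), sq_abs]
  have e3 : ∀ x, (f x ^ 2) ^ 2 = f x ^ 4 := fun x => by rw [← pow_mul]
  simp only [e1, e2, e3, Real.sq_sqrt (abs_nonneg _), sq_abs] at h1 h2
  set A := mean fun x => |f x|
  set B := mean fun x => f x ^ 2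
  set T := mean fun x => |f x| * f x ^ 2
  have hA : 0 ≤ A := mean_nonneg fun x => abs_nonneg _
  have hB : 0 ≤ B := mean_nonneg fun x => by positivity
  rcases hB.eq_or_lt with hB0 | hB0
  · rw [← hB0]; positivity
  have h5 : B ^ 3 * B ≤ B ^ 3 * (9 ^ d * A ^ 2) := by
    calc B ^ 3 * B = (B ^ 2) ^ 2 := by ring
      _ ≤ (A * T) ^ 2 := by gcongr
      _ = A ^ 2 * T ^ 2 := by ring
      _ ≤ A ^ 2 * (B * (9 ^ d * B ^ 2)) := by gcongr; exact h2.trans (by gcongr)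
      _ = _ := by ring
  exact le_of_mul_le_mul_left h5 (by positivity)

lemma sum_mean_oddPart_sq_le {f : Finset α → ℝ} {d : ℕ} (hf : DegreeLE f d) (s : Finset α) :
    ∑ i ∈ s, mean (fun x => oddPart i f x ^ 2) ≤ d * mean fun x => f x ^ 2 := by
  have h : ∀ i, mean (fun x => oddPart i f x ^ 2) = ∑ R, if i ∈ R then hat f R ^ 2 else 0 :=
    fun i => by
      rw [mean_sq]
      exact sum_congr rfl fun R _ => by rw [hat_oddPart]; split_ifs <;> simp
  calc ∑ i ∈ s, mean (fun x => oddPart i f x ^ 2)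
      ≤ ∑ i, mean (fun x => oddPart i f x ^ 2) :=
        sum_le_sum_of_subset_of_nonneg (subset_univ s) fun i _ _ =>
          mean_nonneg fun x => by positivity
    _ = ∑ R : Finset α, (#R : ℝ) * hat f R ^ 2 := by
        simp only [h]
        rw [sum_comm]
        refine sum_congr rfl fun R _ => ?_
        simp
    _ ≤ ∑ R, d * hat f R ^ 2 := by
        refine sum_le_sum fun R _ => ?_
        by_cases hR : d < #R
        · simp [hf R hR]
        · gcongr
          exact not_lt.1 hR
    _ = _ := by rw [← mul_sum, mean_sq]

/-- A low-degree function `q` for which `q ^ 2 - q` is small has influences which are either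
small or bounded from below. -/
lemma mean_oddPart_sq_le {q : Finset α → ℝ} {d : ℕ} (hq : DegreeLE q d) (i : α) :
    mean (fun x => oddPart i q x ^ 2) ≤
      4 * 9 ^ d * mean (fun x => oddPart i q x ^ 2) ^ 2 +
      mean (fun x => oddPart i (fun x => q x ^ 2 - q x) x ^ 2) +
      4 * 3 ^ d * √(mean fun x => (q x ^ 2 - q x) ^ 2) * mean fun x => oddPart i q x ^ 2 := by
  set p : Finset α → ℝ := fun x => q x ^ 2 - q x with hp
  have hpt : ∀ x, oddPart i q x ^ 2 = 4 * oddPart i q x ^ 4 + oddPart i p x ^ 2 -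
      4 * (oddPart i q x ^ 2 * evenPart i p x) := fun x => by
    simp only [oddPart, evenPart, hp]
    ring
  have h1 : mean (fun x => oddPart i q x ^ 2) = 4 * mean (fun x => oddPart i q x ^ 4) +
      mean (fun x => oddPart i p x ^ 2) -
      4 * mean fun x => oddPart i q x ^ 2 * evenPart i p x := by
    rw [← mean_const_mul, ← mean_const_mul, ← mean_add, ← mean_sub]
    exact congrArg mean (funext hpt)
  have h4 := (hq.oddPart i).mean_pow_four_le
  have hE : mean (fun x => evenPart i p x ^ 2) ≤ mean fun x => p x ^ 2 := by
    simp only [mean_sq, hat_evenPart]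
    refine sum_le_sum fun R _ => ?_
    split_ifs
    · simpa using sq_nonneg _
    · rfl
  have h2 := mean_mul_sq_le (fun x => oddPart i q x ^ 2) (evenPart i p)
  simp only [← pow_mul] at h2
  norm_num at h2
  set I := mean fun x => oddPart i q x ^ 2
  set P := mean fun x => p x ^ 2
  have hI : 0 ≤ I := mean_nonneg fun x => by positivity
  have hP : 0 ≤ P := mean_nonneg fun x => by positivity
  have h3 : -(3 ^ d * I * √P) ≤ mean fun x => oddPart i q x ^ 2 * evenPart i p x := by
    refine (abs_le_of_sq_le_sq' (h2.trans ((mul_le_mul h4 hE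
      (mean_nonneg fun x => by positivity) (by positivity)).trans_eq ?_)) (by positivity)).1
    rw [mul_pow, mul_pow, Real.sq_sqrt hP, ← pow_mul, mul_comm d, pow_mul]
    norm_num
  nlinarith

/-- A Boolean function with little Fourier mass above level `d` is close to a junta
(Kindler--Safra). -/
theorem exists_junta_of_weight_le {f : Finset α → ℝ} (hf : ∀ x, f x = 0 ∨ f x = 1) {d : ℕ}
    {η : ℝ} (hη : weight f (fun R => d < #R) ≤ η) (hη' : 256 * 9 ^ (3 * d + 1) * η ≤ 1) :
    ∃ J : Finset α, #J ≤ 8 * 9 ^ d * d ∧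
      weight f (fun R => ¬ R ⊆ J) ≤ (1 + 8 * d * 9 ^ (2 * d + 1)) * η := by
  set q : Finset α → ℝ := fun x => ∑ R, (if d < #R then 0 else hat f R) * chi R x with hqdef
  have hqhat : ∀ R, hat q R = if d < #R then 0 else hat f R := fun R => hat_sum_mul_chi _ R
  have hq : DegreeLE q d := fun R hR => by rw [hqhat, if_pos hR]
  have hη0 : 0 ≤ η := le_trans (sum_nonneg fun R _ => by positivity) hη
  have hfsq : mean (fun x => f x ^ 2) ≤ 1 := by
    refine (mean_mono fun x => ?_).trans_eq (mean_const 1)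
    rcases hf x with h | h <;> simp [h]
  have hqsq : mean (fun x => q x ^ 2) ≤ 1 := by
    refine le_trans ?_ hfsq
    simp only [mean_sq, hqhat]
    refine sum_le_sum fun R _ => ?_
    split_ifs
    · simpa using sq_nonneg _
    · rfl
  have hqf : mean (fun x => (q x - f x) ^ 2) ≤ η := by
    refine le_trans (le_of_eq ?_) hη
    rw [mean_sq, weight, sum_filter]
    refine sum_congr rfl fun R _ => ?_
    rw [hat_sub, hqhat]
    split_ifs <;> ring
  set p : Finset α → ℝ := fun x => q x ^ 2 - q x with hpdef
  have hp : DegreeLE p (2 * d) := by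
    have h := (hq.mul hq).sub (hq.mono (Nat.le_add_left d d))
    simpa only [hpdef, sq, two_mul] using h
  set P := mean fun x => p x ^ 2 with hPdef
  have hP0 : 0 ≤ P := mean_nonneg fun x => by positivity
  have hP : P ≤ 9 ^ (2 * d + 1) * η := by
    refine hp.mean_sq_le_mean_abs.trans ?_
    have h1 := mean_mul_sq_le (fun x => |q x - f x|) fun x => |q x + f x - 1|
    have e : ∀ x, |q x - f x| * |q x + f x - 1| = |p x| := fun x => by
      rw [← abs_mul]
      congr 1
      rcases hf x with h | h <;> simp only [h, hpdef] <;> ring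
    simp only [e, sq_abs] at h1
    have h2 : mean (fun x => (q x + f x - 1) ^ 2) ≤ 9 := by
      have : mean (fun x => (q x + f x - 1) ^ 2) ≤
          mean fun x => 3 * (q x ^ 2 + f x ^ 2) + 3 := mean_mono fun x => by
        nlinarith [sq_nonneg (q x - f x), sq_nonneg (q x + 1), sq_nonneg (f x + 1)]
      rw [mean_add, mean_const_mul, mean_add, mean_const] at this
      linarith
    have h3 : mean (fun x => |p x|) ^ 2 ≤ η * 9 :=
      h1.trans (mul_le_mul hqf h2 (mean_nonneg fun x => by positivity) hη0)
    calc (9 : ℝ) ^ (2 * d) * mean (fun x => |p x|) ^ 2 ≤ 9 ^ (2 * d) * (η * 9) := by gcongr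
      _ = _ := by ring
  have hsP : 4 * 3 ^ d * √P ≤ 1 / 4 := by
    refine abs_le_of_sq_le_sq' ?_ (by norm_num) |>.2
    rw [mul_pow, mul_pow, Real.sq_sqrt hP0, ← pow_mul, mul_comm d, pow_mul]
    have h1 : (9 : ℝ) ^ d * P ≤ 9 ^ d * (9 ^ (2 * d + 1) * η) := by gcongr
    have h2 : (9 : ℝ) ^ d * (9 ^ (2 * d + 1) * η) = 9 ^ (3 * d + 1) * η := by ring
    norm_num
    linarith
  set I : α → ℝ := fun i => mean fun x => oddPart i q x ^ 2 with hI
  have hI0 : ∀ i, 0 ≤ I i := fun i => mean_nonneg fun x => by positivity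
  set J : Finset α := univ.filter fun i => 1 < 8 * 9 ^ d * I i with hJ
  have hJ' : ∀ i ∉ J, 8 * 9 ^ d * I i ≤ 1 := fun i hi => by simpa [hJ] using hi
  refine ⟨J, ?_, ?_⟩
  · have h1 : ∑ i ∈ J, I i ≤ d := by
      refine (sum_mean_oddPart_sq_le hq J).trans ?_
      exact mul_le_of_le_one_right (by positivity) hqsq
    have h2 : (#J : ℝ) ≤ ∑ i ∈ J, 8 * 9 ^ d * I i := by
      rw [card_eq_sum_ones, Nat.cast_sum]
      refine sum_le_sum fun i hi => ?_
      simpa using (mem_filter.1 hi).2.le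
    rw [← mul_sum] at h2
    have h3 : (#J : ℝ) ≤ 8 * 9 ^ d * d := h2.trans (by gcongr)
    exact_mod_cast h3
  · have h1 : ∑ i ∈ univ \ J, I i ≤ 8 * d * P := by
      have h2 : ∀ i ∈ univ \ J, I i / 4 ≤ mean fun x => oddPart i p x ^ 2 := fun i hi => by
        have h3 := mean_oddPart_sq_le hq i
        have h4 := hJ' i (mem_sdiff.1 hi).2
        have h5 := mul_le_mul_of_nonneg_right h4 (hI0 i)
        have h6 := mul_le_mul_of_nonneg_right hsP (hI0 i)
        simp only [hI] at h5 h6 ⊢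
        linarith
      have h3 := (sum_le_sum h2).trans (sum_mean_oddPart_sq_le hp _)
      rw [← sum_div] at h3
      push_cast at h3
      linarith
    have h2 : weight f (fun R => ¬ R ⊆ J) ≤
        weight f (fun R => d < #R) + ∑ i ∈ univ \ J, I i := by
      have e : ∀ i, I i = ∑ R, if i ∈ R then hat q R ^ 2 else 0 := fun i => by
        simp only [hI]
        rw [mean_sq]
        exact sum_congr rfl fun R _ => by rw [hat_oddPart]; split_ifs <;> simp
      simp only [weight, e]
      rw [sum_comm, sum_filter, sum_filter, ← sum_add_distrib]
      refine sum_le_sum fun R _ => ?_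
      have hpos : 0 ≤ ∑ i ∈ univ \ J, if i ∈ R then hat q R ^ 2 else 0 :=
        sum_nonneg fun i _ => by split_ifs <;> positivity
      by_cases h4 : d < #R
      · rw [if_pos h4]
        split_ifs <;> linarith [sq_nonneg (hat f R)]
      · rw [if_neg h4, zero_add]
        split_ifs with h3
        · exact hpos
        · obtain ⟨i, hiR, hiJ⟩ := not_subset.1 h3
          have := single_le_sum (f := fun i => if i ∈ R then hat q R ^ 2 else 0)
            (fun i _ => by split_ifs <;> positivity)
            (mem_sdiff.2 ⟨mem_univ i, hiJ⟩)
          simpa only [hiR, if_true, hqhat, h4, if_false] using this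
    have h3 : 8 * d * P ≤ 8 * d * (9 ^ (2 * d + 1) * η) := by gcongr
    linarith

end CubeFourier

namespace LinearCode

open Finset
open scoped symmDiff

variable {α : Type*} [DecidableEq α]

/-- A binary linear code with coordinate set `R`, no zero coordinate and no repeated coordinate. -/
structure IsCode (C : Finset (Finset α)) (R : Finset α) : Prop where
  subset : ∀ A ∈ C, A ⊆ R
  empty_mem : ∅ ∈ C
  symmDiff_mem : ∀ A ∈ C, ∀ B ∈ C, A ∆ B ∈ C
  exists_mem : ∀ e ∈ R, ∃ A ∈ C, e ∈ A
  exists_separating : ∀ e ∈ R, ∀ e' ∈ R, e ≠ e' → ∃ A ∈ C, ¬ (e ∈ A ↔ e' ∈ A)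

/-- All patterns on `A` are induced by members of `C`. -/
def Shatters (C : Finset (Finset α)) (A : Finset α) : Prop :=
  ∀ B ⊆ A, ∃ D ∈ C, A ∩ D = B

/-- The sign character of coordinate `e`. -/
def sign (e : α) (A : Finset α) : ℤ :=
  if e ∈ A then -1 else 1

lemma sign_symmDiff (e : α) (A B : Finset α) : sign e (A ∆ B) = sign e A * sign e B := by
  unfold sign
  by_cases h1 : e ∈ A <;> by_cases h2 : e ∈ B <;> simp [mem_symmDiff, h1, h2]

variable {C : Finset (Finset α)} {R : Finset α}

lemma IsCode.sum_eq_zero (h : IsCode C R) {χ : Finset α → ℤ}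
    (hχ : ∀ A B, χ (A ∆ B) = χ A * χ B) {D : Finset α} (hD : D ∈ C) (hχD : χ D = -1) :
    ∑ A ∈ C, χ A = 0 := by
  have h1 : ∑ A ∈ C, χ A = ∑ A ∈ C, χ (A ∆ D) :=
    sum_nbij' (· ∆ D) (· ∆ D) (fun A hA => h.symmDiff_mem A hA D hD)
      (fun A hA => h.symmDiff_mem A hA D hD) (by simp) (by simp) (by simp)
  simp only [hχ, hχD, mul_neg_one, sum_neg_distrib] at h1
  omega

lemma IsCode.sum_sign (h : IsCode C R) {e : α} (he : e ∈ R) : ∑ A ∈ C, sign e A = 0 := by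
  obtain ⟨D, hD, heD⟩ := h.exists_mem e he
  exact h.sum_eq_zero (sign_symmDiff e) hD (by simp [sign, heD])

lemma IsCode.sum_sign_mul_sign (h : IsCode C R) {e e' : α} (he : e ∈ R) (he' : e' ∈ R) :
    ∑ A ∈ C, sign e A * sign e' A = if e = e' then (#C : ℤ) else 0 := by
  split_ifs with hee
  · subst hee
    have : ∀ A, sign e A * sign e A = 1 := fun A => by unfold sign; split_ifs <;> rfl
    simp [this]
  · obtain ⟨D, hD, heD⟩ := h.exists_separating e he e' he' hee
    refine h.sum_eq_zero (χ := fun A => sign e A * sign e' A)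
      (fun A B => by simp only [sign_symmDiff]; ring) hD ?_
    unfold sign
    by_cases h1 : e ∈ D <;> by_cases h2 : e' ∈ D <;> simp_all

lemma IsCode.sum_sign_eq (h : IsCode C R) {A : Finset α} (hA : A ∈ C) :
    ∑ e ∈ R, sign e A = #R - 2 * #A := by
  have h1 : ∀ e, sign e A = 1 - 2 * if e ∈ A then 1 else 0 := fun e => by
    unfold sign; split_ifs <;> norm_num
  simp only [h1, sum_sub_distrib, ← mul_sum, sum_boole]
  rw [filter_mem_eq_inter, inter_eq_right.2 (h.subset A hA)]
  simp

/-- The first two moments of the weight distribution of a code. -/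
lemma IsCode.sum_quadratic (h : IsCode C R) (a b c : ℤ) :
    4 * ∑ A ∈ C.erase ∅, (a + b * #A + c * (#A : ℤ) ^ 2) =
      4 * a * (#C - 1) + 2 * b * #R * #C + c * #R * (#R + 1) * #C := by
  have h1 : ∑ A ∈ C, ((#R : ℤ) - 2 * #A) = 0 := by
    rw [sum_congr rfl fun A hA => (h.sum_sign_eq hA).symm, sum_comm]
    exact Finset.sum_eq_zero fun e he => h.sum_sign he
  have h2 : ∑ A ∈ C, ((#R : ℤ) - 2 * #A) ^ 2 = (#R : ℤ) * #C := by
    have e1 : ∀ A ∈ C, ((#R : ℤ) - 2 * #A) ^ 2 = ∑ e ∈ R, ∑ e' ∈ R, sign e A * sign e' A :=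
      fun A hA => by rw [← h.sum_sign_eq hA, sq, sum_mul_sum]
    have e2 : ∀ e ∈ R, ∑ A ∈ C, ∑ e' ∈ R, sign e A * sign e' A = #C := fun e he => by
      rw [sum_comm, sum_congr rfl fun e' he' => h.sum_sign_mul_sign he he']
      simp [he]
    rw [sum_congr rfl e1, sum_comm, sum_congr rfl e2]
    simp
  have h3 : ∑ A ∈ C, ((#R : ℤ) - 2 * #A) ^ 2 =
      ∑ A ∈ C, ((#R : ℤ) ^ 2 - 4 * #R * #A + 4 * (#A : ℤ) ^ 2) :=
    sum_congr rfl fun A _ => by ring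
  have h4 := add_sum_erase C (fun A => a + b * #A + c * (#A : ℤ) ^ 2) h.empty_mem
  simp only [sum_add_distrib, sum_sub_distrib, ← mul_sum, sum_const, nsmul_eq_mul, card_empty]
    at h1 h2 h3 h4 ⊢
  rw [h2] at h3
  push_cast at *
  have h5 : 2 * ∑ A ∈ C, (#A : ℤ) = #R * #C := by linarith
  have h6 : 4 * ∑ A ∈ C, (#A : ℤ) ^ 2 = #R * (#R + 1) * #C := by
    linear_combination -h3 + 2 * (#R : ℤ) * h5
  linear_combination 4 * h4 + 2 * b * h5 + c * h6

lemma IsCode.card_lt (h : IsCode C R) (hR : R.Nonempty) : #R < #C := by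
  have hm : (0 : ℤ) < #R := by exact_mod_cast hR.card_pos
  have h1 := h.sum_quadratic ((#R : ℤ) ^ 2) (-4 * #R) 4
  have h2 : ∀ A ∈ C.erase ∅, (0 : ℤ) ≤ (#R : ℤ) ^ 2 + -4 * #R * #A + 4 * (#A : ℤ) ^ 2 :=
    fun A _ => by nlinarith [sq_nonneg ((#R : ℤ) - 2 * #A)]
  have h3 := sum_nonneg h2
  have h4 : (#R : ℤ) ≤ #C := by nlinarith
  refine lt_of_le_of_ne (by exact_mod_cast h4) fun h5 => ?_
  have h6 : ∑ A ∈ C.erase ∅, ((#R : ℤ) ^ 2 + -4 * #R * #A + 4 * (#A : ℤ) ^ 2) = 0 := by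
    rw [← h5] at h1
    linarith
  have h7 : ∀ A ∈ C.erase ∅, (#R : ℤ) + -2 * #A + 0 * (#A : ℤ) ^ 2 = 0 := fun A hA => by
    have := (sum_eq_zero_iff_of_nonneg h2).1 h6 A hA
    nlinarith [sq_nonneg ((#R : ℤ) - 2 * #A)]
  have h8 := h.sum_quadratic (#R : ℤ) (-2) 0
  rw [Finset.sum_eq_zero h7, ← h5] at h8
  nlinarith

lemma IsCode.exists_information_set (h : IsCode C R) :
    ∃ I ⊆ R, #C = 2 ^ #I ∧ Shatters C I ∧
      ∀ φ : Finset α → ℤ, ∑ A ∈ C, φ (A ∩ I) = ∑ B ∈ I.powerset, φ B := by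
  classical
  obtain ⟨I, hI, hmax⟩ := exists_max_image (R.powerset.filter (Shatters C)) card
    ⟨∅, by
      simp only [mem_filter, mem_powerset, empty_subset, true_and]
      exact fun B hB => ⟨∅, h.empty_mem, by simpa using (subset_empty.1 hB).symm⟩⟩
  simp only [mem_filter, mem_powerset] at hI hmax
  obtain ⟨hIR, hI⟩ := hI
  have hinj : ∀ A ∈ C, ∀ B ∈ C, A ∩ I = B ∩ I → A = B := by
    intro A hA B hB hAB
    by_contra hne
    have hD := h.symmDiff_mem A hA B hB
    have hDI : ∀ e ∈ I, e ∉ A ∆ B := fun e he => by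
      have := congrArg (e ∈ ·) hAB
      simp only [mem_inter, he, and_true, eq_iff_iff] at this
      simp [mem_symmDiff, this]
    obtain ⟨e, he⟩ : (A ∆ B).Nonempty := by
      rw [nonempty_iff_ne_empty, ← bot_eq_empty, Ne, symmDiff_eq_bot]
      exact hne
    have heI : e ∉ I := fun hh => hDI e hh he
    have := hmax (insert e I) ⟨insert_subset (h.subset _ hD he) hIR, fun P hP => by
      obtain ⟨E, hE, hEP⟩ := hI (P ∩ I) inter_subset_right
      have hEP' : ∀ i ∈ I, i ∈ E ↔ i ∈ P := fun i hi => by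
        have := congrArg (i ∈ ·) hEP
        simpa [hi] using this
      by_cases heq : e ∈ E ↔ e ∈ P
      · refine ⟨E, hE, ext fun i => ?_⟩
        have h1 := hEP' i
        have h2 := @hP i
        rw [mem_insert] at h2
        rw [mem_inter, mem_insert]
        by_cases hi : i = e
        · subst hi; tauto
        · tauto
      · refine ⟨E ∆ (A ∆ B), h.symmDiff_mem _ hE _ hD, ext fun i => ?_⟩
        have h1 := hEP' i
        have h2 := @hP i
        have h3 := hDI i
        rw [mem_insert] at h2
        rw [mem_inter, mem_insert, mem_symmDiff]
        by_cases hi : i = e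
        · subst hi; tauto
        · tauto⟩
    rw [card_insert_of_notMem heI] at this
    omega
  have hφ : ∀ φ : Finset α → ℤ, ∑ A ∈ C, φ (A ∩ I) = ∑ B ∈ I.powerset, φ B := fun φ => by
    refine sum_bij (fun A _ => A ∩ I) (fun A _ => mem_powerset.2 inter_subset_right)
      (fun A hA B hB => hinj A hA B hB) (fun B hB => ?_) fun _ _ => rfl
    obtain ⟨D, hD, hDB⟩ := hI B (mem_powerset.1 hB)
    exact ⟨D, hD, by rwa [inter_comm]⟩
  refine ⟨I, hIR, ?_, hI, hφ⟩
  have := hφ fun _ => 1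
  simp only [sum_const, mul_one, card_powerset, nsmul_eq_mul] at this
  exact_mod_cast this

/-- The weights of the cut statistics: they depend on the size of a set, and for four-element
sets also on whether the set is shattered. -/
structure IsCutWeight (S : Finset α → Prop) (b : Finset α → ℤ) : Prop where
  empty : b ∅ = 56
  one : ∀ A, #A = 1 → b A = -40
  two : ∀ A, #A = 2 → b A = -8
  three : ∀ A, #A = 3 → b A = 6
  four : ∀ A, #A = 4 → S A → b A = 1
  four' : ∀ A, #A = 4 → ¬ S A → b A = -1
  five : ∀ A, 5 ≤ #A → b A = 0

namespace IsCutWeight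

variable {S : Finset α → Prop} {b : Finset α → ℤ}

omit [DecidableEq α] in
lemma cases (hb : IsCutWeight S b) {A : Finset α} (hA : A ≠ ∅) :
    (#A = 1 ∧ b A = -40) ∨ (#A = 2 ∧ b A = -8) ∨ (#A = 3 ∧ b A = 6) ∨
      (#A = 4 ∧ b A = 1 ∧ S A) ∨ (#A = 4 ∧ b A = -1 ∧ ¬ S A) ∨ (5 ≤ #A ∧ b A = 0) := by
  have h0 := card_pos.2 (nonempty_iff_ne_empty.2 hA)
  have h1 := hb.one A
  have h2 := hb.two A
  have h3 := hb.three A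
  have h4 := hb.four A
  have h5 := hb.four' A
  have h6 := hb.five A
  rcases (by omega : #A = 1 ∨ #A = 2 ∨ #A = 3 ∨ #A = 4 ∨ 5 ≤ #A) with h | h | h | h | h
  · exact Or.inl ⟨h, h1 h⟩
  · exact Or.inr (Or.inl ⟨h, h2 h⟩)
  · exact Or.inr (Or.inr (Or.inl ⟨h, h3 h⟩))
  · by_cases hS : S A
    · exact Or.inr (Or.inr (Or.inr (Or.inl ⟨h, h4 h hS, hS⟩)))
    · exact Or.inr (Or.inr (Or.inr (Or.inr (Or.inl ⟨h, h5 h hS, hS⟩))))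
  · exact Or.inr (Or.inr (Or.inr (Or.inr (Or.inr ⟨h, h6 h⟩))))

lemma sum_le (hb : IsCutWeight S b) (h : IsCode C R) (w x y z : ℤ)
    (hp : ∀ A ∈ C, A ≠ ∅ → w * b A ≤ x + y * #A + z * (#A : ℤ) ^ 2) :
    4 * w * ∑ A ∈ C, b A ≤
      224 * w + (4 * x * (#C - 1) + 2 * y * #R * #C + z * #R * (#R + 1) * #C) := by
  rw [← h.sum_quadratic, ← add_sum_erase C b h.empty_mem, hb.empty, mul_add, mul_assoc 4 w,
    mul_assoc 4 w, mul_sum _ _ w]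
  have := Finset.sum_le_sum (s := C.erase ∅) (f := fun A => w * b A)
    (g := fun A => x + y * #A + z * (#A : ℤ) ^ 2)
    fun A hA => hp A (mem_of_mem_erase hA) (ne_of_mem_erase hA)
  linarith

lemma le_sum (hb : IsCutWeight S b) (h : IsCode C R) (w x y z : ℤ)
    (hp : ∀ A ∈ C, A ≠ ∅ → x + y * #A + z * (#A : ℤ) ^ 2 ≤ w * b A) :
    224 * w + (4 * x * (#C - 1) + 2 * y * #R * #C + z * #R * (#R + 1) * #C) ≤
      4 * w * ∑ A ∈ C, b A := by
  rw [← h.sum_quadratic, ← add_sum_erase C b h.empty_mem, hb.empty, mul_add, mul_assoc 4 w,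
    mul_assoc 4 w, mul_sum _ _ w]
  have := Finset.sum_le_sum (s := C.erase ∅) (g := fun A => w * b A)
    (f := fun A => x + y * #A + z * (#A : ℤ) ^ 2)
    fun A hA => hp A (mem_of_mem_erase hA) (ne_of_mem_erase hA)
  linarith

lemma le_sum_of_even_of_five_le (hb : IsCutWeight S b) (h : IsCode C R) {I : Finset α}
    (hI : 5 ≤ #I) (hC : #C = 2 ^ #I)
    (hφ : ∀ φ : Finset α → ℤ, ∑ A ∈ C, φ (A ∩ I) = ∑ B ∈ I.powerset, φ B) :
    -127 * (#C : ℤ) ≤ 16 * ∑ A ∈ C, b A := by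
  let g : ℕ → ℤ := fun k =>
    -1 + (if k = 0 then 57 else 0) - (if k = 1 then 39 else 0) - if k = 2 then 7 else 0
  have hinj : ∀ A ∈ C, A ∩ I = ∅ → A = ∅ := by
    intro A hA hAI
    by_contra hne
    have h1 := hφ fun B => if B = ∅ then 1 else 0
    rw [sum_boole, sum_ite_eq' I.powerset ∅, if_pos (empty_mem_powerset I)] at h1
    have h2 : #(C.filter fun A => A ∩ I = ∅) = 1 := by exact_mod_cast h1
    obtain ⟨D, hD⟩ := card_eq_one.1 h2
    have e1 : A ∈ C.filter fun A => A ∩ I = ∅ := mem_filter.2 ⟨hA, hAI⟩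
    have e2 : ∅ ∈ C.filter fun A => A ∩ I = ∅ := mem_filter.2 ⟨h.empty_mem, empty_inter I⟩
    rw [hD, mem_singleton] at e1 e2
    exact hne (e1.trans e2.symm)
  have h1 : ∑ A ∈ C, g #(A ∩ I) ≤ ∑ A ∈ C, b A := by
    refine Finset.sum_le_sum fun A hA => ?_
    by_cases hA0 : A = ∅
    · subst hA0; simp [g, hb.empty]
    · have h2 : #(A ∩ I) ≠ 0 := fun h0 => hA0 (hinj A hA (card_eq_zero.1 h0))
      have h3 : #(A ∩ I) ≤ #A := card_le_card inter_subset_left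
      have h4 := hb.cases hA0
      simp only [g]
      split_ifs <;> omega
  rw [hφ fun B => g #B, sum_powerset_apply_card g] at h1
  have h5 : ∑ k ∈ range (#I + 1), (#I).choose k • g k =
      57 - 39 * (#I : ℤ) - 7 * ((#I).choose 2 : ℤ) - 2 ^ #I := by
    have e := Nat.sum_range_choose #I
    have e' : ∑ k ∈ range (#I + 1), ((#I).choose k : ℤ) = 2 ^ #I := by exact_mod_cast e
    simp only [g, nsmul_eq_mul, mul_sub, mul_add, sum_sub_distrib, sum_add_distrib, mul_ite,
      mul_zero, sum_ite_eq', mem_range, mul_neg, mul_one, sum_neg_distrib, e']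
    rw [if_pos (by omega), if_pos (by omega), if_pos (by omega)]
    simp
    ring
  have h6 : 2 * ((#I).choose 2 : ℤ) = #I * (#I - 1) := by
    have := Nat.cast_choose_two ℚ #I
    have h' : 2 * ((#I).choose 2 : ℚ) = #I * (#I - 1) := by rw [this]; ring
    exact_mod_cast h'
  have h7 : ∀ r : ℕ, 5 ≤ r → (568 * r + 56 * r ^ 2 : ℤ) ≤ 111 * 2 ^ r + 912 := by
    intro r hr
    induction r, hr using Nat.le_induction with
    | base => norm_num
    | succ r hr ih =>
      have : (5 : ℤ) ≤ r := by exact_mod_cast hr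
      rw [pow_succ (2 : ℤ)]
      push_cast
      nlinarith
  have h8 := h7 _ hI
  rw [hC]
  push_cast
  nlinarith

end IsCutWeight

/-- The spectral gap: cut statistics of a set `R` of coordinates. -/
theorem IsCutWeight.bounds {S : Finset α → Prop} {b : Finset α → ℤ} (hb : IsCutWeight S b)
    (h : IsCode C R) (hR : R.Nonempty) (hS : ∀ A ⊆ R, S A ↔ Shatters C A) :
    -8 * (#C : ℤ) ≤ (-1) ^ #R * ∑ A ∈ C, b A ∧
      (4 ≤ #R → -127 * (#C : ℤ) ≤ 16 * ((-1) ^ #R * ∑ A ∈ C, b A)) := by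
  obtain ⟨I, hIR, hC, hI, hφ⟩ := h.exists_information_set
  have hlt := h.card_lt hR
  have hRI := card_le_card hIR
  have hm0 := hR.card_pos
  have hshat : ∀ A ∈ C, #I < #A → ¬ S A := by
    intro A hA hlt hSA
    have h1 := (hS A (h.subset A hA)).1 hSA
    have h2 : #A.powerset ≤ #C := by
      choose! D hD hAD using h1
      refine card_le_card_of_injOn D (fun B hB => hD B (mem_powerset.1 hB))
        fun B hB B' hB' hBB => ?_
      rw [← hAD B (mem_powerset.1 hB), hBB, hAD B' (mem_powerset.1 hB')]
    rw [card_powerset, hC] at h2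
    exact absurd ((Nat.pow_le_pow_iff_right (by norm_num)).1 h2) (by omega)
  suffices hmain : (#R ≤ 3 → -8 * (#C : ℤ) ≤ (-1) ^ #R * ∑ A ∈ C, b A) ∧
      (4 ≤ #R → -127 * (#C : ℤ) ≤ 16 * ((-1) ^ #R * ∑ A ∈ C, b A)) by
    refine ⟨?_, hmain.2⟩
    by_cases h3 : #R ≤ 3
    · exact hmain.1 h3
    · have := hmain.2 (by omega)
      omega
  have hupper := hb.sum_le h
  have hlower := hb.le_sum h
  have hcard : ∀ A ∈ C, #A ≤ #R := fun A hA => card_le_card (h.subset A hA)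
  have hquad := h.sum_quadratic 9 (-6) 1
  have hfull : #I = #R → C = R.powerset := fun hr =>
    eq_of_subset_of_card_le (fun A hA => mem_powerset.2 (h.subset A hA))
      (by rw [card_powerset, hC, hr])
  have hlarge := hb.le_sum_of_even_of_five_le h (I := I)
  have hcases : ∀ A ∈ C, A ≠ ∅ → (#A = 1 ∧ b A = -40) ∨ (#A = 2 ∧ b A = -8) ∨
      (#A = 3 ∧ b A = 6) ∨ (#A = 4 ∧ b A = 1 ∧ 4 ≤ #I) ∨ (#A = 4 ∧ b A = -1) ∨
      (5 ≤ #A ∧ b A = 0) := by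
    intro A hA hA0
    have h1 := hshat A hA
    rcases hb.cases hA0 with h | h | h | ⟨h, h', hSA⟩ | h | h
    · omega
    · omega
    · omega
    · have : ¬ #I < #A := fun hlt => h1 hlt hSA
      omega
    · omega
    · omega
  generalize hm : #R = m at *
  rcases Nat.even_or_odd m with hpar | hpar
  · rw [hpar.neg_one_pow, one_mul]
    by_cases hr5 : 5 ≤ #I
    · exact ⟨fun h3 => by omega, fun _ => hlarge hr5 hC hφ⟩
    clear hlarge hquad hupper hφ
    have hlower' : ∀ w x y z : ℤ, (∀ k : ℕ, ∀ v : ℤ, k ≤ m → 1 ≤ k → ((k = 1 ∧ v = -40) ∨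
        (k = 2 ∧ v = -8) ∨ (k = 3 ∧ v = 6) ∨ (k = 4 ∧ v = 1 ∧ 4 ≤ #I) ∨ (k = 4 ∧ v = -1) ∨
        (5 ≤ k ∧ v = 0)) → x + y * k + z * (k : ℤ) ^ 2 ≤ w * v) → _ :=
      fun w x y z hp => hlower w x y z fun A hA hA0 =>
        hp #A (b A) (hcard A hA) (card_pos.2 (nonempty_iff_ne_empty.2 hA0)) (hcases A hA hA0)
    clear hlower
    generalize hr : #I = r at *
    have hsmall : (r = 2 ∧ m = 2) ∨ (r = 3 ∧ m = 4) ∨ (r = 3 ∧ m = 6) ∨ (r = 4 ∧ m = 4) ∨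
        (r = 4 ∧ 6 ≤ m ∧ m ≤ 14) := by
      rw [hC] at hlt
      obtain ⟨j, hj⟩ := hpar
      interval_cases r <;> omega
    rcases hsmall with ⟨rfl, rfl⟩ | ⟨rfl, rfl⟩ | ⟨rfl, rfl⟩ | ⟨rfl, rfl⟩ | ⟨rfl, h6, h14⟩
    · have h1 := hlower' 1 (-72) 32 0 fun k v _ _ _ => by interval_cases k <;> omega
      rw [hC] at h1 ⊢
      norm_num at h1 ⊢
      omega
    · have h1 := hlower' 1 (-92) 62 (-10) fun k v _ _ _ => by
        interval_cases k <;> norm_num <;> omega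
      rw [hC] at h1 ⊢
      norm_num at h1 ⊢
      omega
    · have h1 := hlower' 16 (-16 - 39 * 36) (156 * 6) (-156) fun k v _ _ _ => by
        interval_cases k <;> norm_num <;> omega
      rw [hC] at h1 ⊢
      norm_num at h1 ⊢
      omega
    · let g : ℕ → ℤ := fun k =>
        if k = 0 then 56 else if k = 1 then -40 else if k = 2 then -8 else if k = 3 then 6 else 1
      have hg : ∑ A ∈ C, b A = ∑ A ∈ R.powerset, g #A := by
        rw [hfull rfl]
        refine sum_congr rfl fun A hA => ?_
        have hAR := mem_powerset.1 hA
        have hcard := card_le_card hAR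
        by_cases hA0 : A = ∅
        · simp [hA0, hb.empty, g]
        · rcases hb.cases hA0 with ⟨h, h'⟩ | ⟨h, h'⟩ | ⟨h, h'⟩ | ⟨h, h', -⟩ | ⟨h, h', hSA⟩ | ⟨h, h'⟩
          · simp [h, h', g]
          · simp [h, h', g]
          · simp [h, h', g]
          · simp [h, h', g]
          · refine absurd ((hS A hAR).2 ?_) hSA
            exact fun B hB => ⟨B, hfull rfl ▸ mem_powerset.2 (hB.trans hAR), inter_eq_right.2 hB⟩
          · omega
      rw [hg, sum_powerset_apply_card g, hm, hC]
      simp [g, sum_range_succ, Nat.choose]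
    · have h1 := hlower' 16 (-16 - 39 * m ^ 2) (156 * m) (-156) fun k v hk _ _ => by
        have := hk.trans h14
        interval_cases k <;> norm_num <;> interval_cases m <;> norm_num <;> omega
      rw [hC] at h1 ⊢
      interval_cases m <;> norm_num at h1 ⊢ <;> omega
  · rw [hpar.neg_one_pow]
    by_cases hr5 : 5 ≤ #I
    · refine ⟨fun h3 => by omega, fun _ => ?_⟩
      have h1 := hupper 1 6 0 0 fun A hA hA0 => by have := hb.cases hA0; omega
      have h2 : 2 ^ 5 ≤ #C := hC ▸ Nat.pow_le_pow_right (by norm_num) hr5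
      push_cast at *
      omega
    clear hlarge hlower hφ
    have hupper' : ∀ w x y z : ℤ, (∀ k : ℕ, ∀ v : ℤ, k ≤ m → 1 ≤ k → ((k = 1 ∧ v = -40) ∨
        (k = 2 ∧ v = -8) ∨ (k = 3 ∧ v = 6) ∨ (k = 4 ∧ v = 1 ∧ 4 ≤ #I) ∨ (k = 4 ∧ v = -1) ∨
        (5 ≤ k ∧ v = 0)) → w * v ≤ x + y * k + z * (k : ℤ) ^ 2) → _ :=
      fun w x y z hp => hupper w x y z fun A hA hA0 =>
        hp #A (b A) (hcard A hA) (card_pos.2 (nonempty_iff_ne_empty.2 hA0)) (hcases A hA hA0)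
    generalize hr : #I = r at *
    have hsmall : (r = 1 ∧ m = 1) ∨ (r = 2 ∧ m = 3) ∨ (r = 3 ∧ m = 3) ∨ (r = 3 ∧ m = 5) ∨
        (r = 3 ∧ m = 7) ∨ (r = 4 ∧ m = 5) ∨ (r = 4 ∧ 7 ≤ m ∧ m ≤ 13 ∧ m % 2 = 1) ∨
        (r = 4 ∧ m = 15) := by
      rw [hC] at hlt
      obtain ⟨j, hj⟩ := hpar
      interval_cases r <;> omega
    rcases hsmall with ⟨rfl, rfl⟩ | ⟨rfl, rfl⟩ | ⟨rfl, rfl⟩ | ⟨rfl, rfl⟩ | ⟨rfl, rfl⟩ | ⟨rfl, rfl⟩ |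
      ⟨rfl, h7, h13, hodd⟩ | ⟨rfl, rfl⟩
    · have h1 := hupper' 1 (-40) 0 0 fun k v _ _ _ => by interval_cases k <;> omega
      rw [hC] at h1 ⊢
      norm_num at h1 ⊢
      omega
    · have h1 := hupper' 1 (-36) 14 0 fun k v _ _ _ => by interval_cases k <;> omega
      rw [hC] at h1 ⊢
      norm_num at h1 ⊢
      omega
    · have h1 := hupper' 1 (-36) 14 0 fun k v _ _ _ => by interval_cases k <;> omega
      rw [hC] at h1 ⊢
      norm_num at h1 ⊢
      omega
    · have hsq : ∀ A ∈ C.erase ∅, (9 : ℤ) + -6 * #A + 1 * (#A : ℤ) ^ 2 ≤ 3 := fun A hA => by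
        have h1 := single_le_sum (f := fun A : Finset α => (9 : ℤ) + -6 * #A + 1 * (#A : ℤ) ^ 2)
          (fun B _ => by nlinarith [sq_nonneg ((#B : ℤ) - 3)]) hA
        rw [hC] at hquad
        norm_num at hquad h1 ⊢
        omega
      have h1 := hupper 2 (-198) 133 (-21) fun A hA hA0 => by
        have h2 := hsq A (mem_erase.2 ⟨hA0, hA⟩)
        have h3 := hcases A hA hA0
        have h4 := hcard A hA
        generalize #A = k at *
        interval_cases k <;> push_cast at h2 ⊢ <;> omega
      rw [hC] at h1 ⊢
      norm_num at h1 ⊢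
      omega
    · have h1 := hupper' 1 191 (-96) 12 fun k v _ _ _ => by
        interval_cases k <;> norm_num <;> omega
      rw [hC] at h1 ⊢
      norm_num at h1 ⊢
      omega
    · have h1 := hupper' 2 (-15) 18 (-3) fun k v _ _ _ => by
        interval_cases k <;> norm_num <;> omega
      rw [hC] at h1 ⊢
      norm_num at h1 ⊢
      omega
    · have h1 := hupper' 1 30 (-11) 1 fun k v hk _ _ => by
        have := hk.trans h13
        interval_cases k <;> norm_num <;> omega
      rw [hC] at h1 ⊢
      interval_cases m <;> norm_num at h1 ⊢ <;> omega
    · have h1 := hupper' 1 64 (-16) 1 fun k v _ _ _ => by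
        interval_cases k <;> norm_num <;> omega
      rw [hC] at h1 ⊢
      norm_num at h1 ⊢
      omega

end LinearCode

namespace LinearCode

open Finset
open scoped symmDiff

variable {α : Type*} [DecidableEq α]

open Classical in
/-- The statistic of a cut whose average over all cuts gives the spectrum of the weighted
agreement operator. -/
noncomputable def cutWeight (Z : Finset (Finset α)) (A : Finset α) : ℤ :=
  if #A = 0 then 56 else if #A = 1 then -40 else if #A = 2 then -8 else if #A = 3 then 6 else
    if #A = 4 then if Shatters Z A then 1 else -1 else 0

lemma isCutWeight_cutWeight (Z : Finset (Finset α)) :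
    IsCutWeight (Shatters Z) (cutWeight Z) where
  empty := by simp [cutWeight]
  one A h := by simp [cutWeight, h]
  two A h := by simp [cutWeight, h]
  three A h := by simp [cutWeight, h]
  four A h hS := by simp [cutWeight, h, hS]
  four' A h hS := by simp [cutWeight, h, hS]
  five A h := by
    unfold cutWeight
    rw [if_neg (by omega), if_neg (by omega), if_neg (by omega), if_neg (by omega),
      if_neg (by omega)]

variable {Z : Finset (Finset α)} {E : Finset α}

lemma inter_symmDiff_distrib (R A B : Finset α) : R ∩ (A ∆ B) = (R ∩ A) ∆ (R ∩ B) :=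
  inf_symmDiff_distrib_left R A B

lemma IsCode.restrict (h : IsCode Z E) {R : Finset α} (hR : R ⊆ E) :
    IsCode (Z.image (R ∩ ·)) R where
  subset A hA := by
    obtain ⟨B, -, rfl⟩ := mem_image.1 hA
    exact inter_subset_left
  empty_mem := mem_image.2 ⟨∅, h.empty_mem, inter_empty R⟩
  symmDiff_mem A hA B hB := by
    obtain ⟨A, hA', rfl⟩ := mem_image.1 hA
    obtain ⟨B, hB', rfl⟩ := mem_image.1 hB
    exact mem_image.2 ⟨A ∆ B, h.symmDiff_mem A hA' B hB', inter_symmDiff_distrib R A B⟩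
  exists_mem e he := by
    obtain ⟨A, hA, heA⟩ := h.exists_mem e (hR he)
    exact ⟨R ∩ A, mem_image_of_mem _ hA, mem_inter.2 ⟨he, heA⟩⟩
  exists_separating e he e' he' hee := by
    obtain ⟨A, hA, heA⟩ := h.exists_separating e (hR he) e' (hR he') hee
    exact ⟨R ∩ A, mem_image_of_mem _ hA, by simpa [he, he'] using heA⟩

lemma IsCode.sum_inter (h : IsCode Z E) (R : Finset α) (φ : Finset α → ℤ) :
    ∑ B ∈ Z, φ (R ∩ B) = #{B ∈ Z | R ∩ B = ∅} * ∑ A ∈ Z.image (R ∩ ·), φ A := by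
  rw [sum_comp φ (R ∩ ·), mul_sum]
  refine sum_congr rfl fun A hA => ?_
  obtain ⟨D, hD, rfl⟩ := mem_image.1 hA
  rw [nsmul_eq_mul]
  congr 2
  refine card_nbij' (· ∆ D) (· ∆ D) (fun B hB => ?_) (fun B hB => ?_)
    (fun B _ => symmDiff_symmDiff_cancel_right D B) fun B _ => symmDiff_symmDiff_cancel_right D B
  · obtain ⟨hB, hBD⟩ := mem_filter.1 hB
    exact mem_filter.2 ⟨h.symmDiff_mem B hB D hD, by
      rw [inter_symmDiff_distrib, hBD, symmDiff_self, bot_eq_empty]⟩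
  · obtain ⟨hB, hBD⟩ := mem_filter.1 hB
    exact mem_filter.2 ⟨h.symmDiff_mem B hB D hD, by
      rw [inter_symmDiff_distrib, hBD, ← bot_eq_empty, bot_symmDiff]⟩

/-- Lower bounds for the spectrum of the weighted agreement operator. -/
theorem IsCode.cutWeight_bounds (h : IsCode Z E) {R : Finset α} (hRE : R ⊆ E)
    (hR : R.Nonempty) :
    -8 * (#Z : ℤ) ≤ (-1) ^ #R * ∑ B ∈ Z, cutWeight Z (R ∩ B) ∧
      (4 ≤ #R → -127 * (#Z : ℤ) ≤ 16 * ((-1) ^ #R * ∑ B ∈ Z, cutWeight Z (R ∩ B))) := by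
  have hS : ∀ A ⊆ R, Shatters Z A ↔ Shatters (Z.image (R ∩ ·)) A := by
    intro A hA
    have : ∀ D, A ∩ (R ∩ D) = A ∩ D := fun D => by
      rw [← inter_assoc, inter_eq_left.2 hA]
    simp [Shatters, this]
  have hb := (isCutWeight_cutWeight Z).bounds (h.restrict hRE) hR hS
  have hZ := h.sum_inter R fun _ => 1
  simp only [sum_const, nsmul_eq_mul, mul_one] at hZ
  rw [h.sum_inter R, hZ]
  set K : ℤ := (#{B ∈ Z | R ∩ B = ∅} : ℤ)
  have hK : 0 ≤ K := Int.natCast_nonneg _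
  refine ⟨?_, fun h4 => ?_⟩
  · nlinarith [mul_le_mul_of_nonneg_left hb.1 hK]
  · nlinarith [mul_le_mul_of_nonneg_left (hb.2 h4) hK]

end LinearCode

namespace CubeFourier

open Finset LinearCode
open scoped symmDiff

variable {α : Type*} [Fintype α] [DecidableEq α]

/-- Any two members of the family agree on a coordinate outside every member of `Z`. -/
def CutAgreeing (Z F : Finset (Finset α)) : Prop :=
  ∀ G ∈ F, ∀ H ∈ F, ∀ B ∈ Z, ∃ e, e ∉ G ∆ H ∧ e ∉ B

/-- The indicator function of a family. -/
def ind (F : Finset (Finset α)) (x : Finset α) : ℝ :=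
  if x ∈ F then 1 else 0

omit [Fintype α] in
lemma ind_eq_zero_or_one (F : Finset (Finset α)) (x : Finset α) : ind F x = 0 ∨ ind F x = 1 := by
  unfold ind
  split_ifs <;> simp

lemma mean_ind (F : Finset (Finset α)) : mean (ind F) = #F / 2 ^ Fintype.card α := by
  simp [mean, ind]

lemma mean_ind_sq (F : Finset (Finset α)) : mean (fun x => ind F x ^ 2) = mean (ind F) := by
  congr 1
  ext x
  rcases ind_eq_zero_or_one F x with h | h <;> simp [h]

lemma neg_one_pow_card (R : Finset α) : (-1 : ℝ) ^ #R = chi R univ := by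
  simp [chi]

lemma sum_mul_hat_sq (w : Finset α → ℝ) (f : Finset α → ℝ) :
    ∑ R, w R * hat f R ^ 2 =
      mean fun x => f x * mean fun y => f y * ∑ R, w R * chi R (x ∆ y) := by
  have h1 : ∀ R, w R * hat f R ^ 2 =
      mean fun x => f x * mean fun y => f y * (w R * chi R (x ∆ y)) := by
    intro R
    have e1 : ∀ x, (mean fun y => f y * (w R * chi R (x ∆ y))) = w R * chi R x * hat f R := by
      intro x
      rw [hat, ← mean_const_mul]
      congr 1
      ext y
      rw [chi_symmDiff]
      ring
    have e2 : ∀ x, f x * (w R * chi R x * hat f R) = w R * hat f R * (f x * chi R x) :=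
      fun x => by ring
    simp only [e1, e2, mean_const_mul]
    rw [← hat]
    ring
  simp only [h1, ← mean_sum, ← mul_sum]

lemma CutAgreeing.sum_eq_zero {Z F : Finset (Finset α)} (hF : CutAgreeing Z F) {B : Finset α}
    (hB : B ∈ Z) (b : Finset α → ℝ) :
    ∑ R, (-1) ^ #R * b (R ∩ B) * hat (ind F) R ^ 2 = 0 := by
  rw [sum_mul_hat_sq]
  have h : ∀ x y, ind F x * (ind F y * ∑ R, (-1) ^ #R * b (R ∩ B) * chi R (x ∆ y)) = 0 := by
    intro x y
    by_cases hx : x ∈ F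
    swap
    · simp [ind, hx]
    by_cases hy : y ∈ F
    swap
    · simp [ind, hy]
    obtain ⟨e, he, heB⟩ := hF x hx y hy B hB
    have h1 : ∑ R, (-1) ^ #R * b (R ∩ B) * chi R (x ∆ y) =
        ∑ R, (-1) ^ #(R ∆ {e}) * b ((R ∆ {e}) ∩ B) * chi (R ∆ {e}) (x ∆ y) :=
      sum_nbij' (· ∆ {e}) (· ∆ {e}) (by simp) (by simp) (by simp) (by simp) (by simp)
    have h2 : ∀ R : Finset α, (R ∆ {e}) ∩ B = R ∩ B := fun R => by
      ext i
      by_cases hi : i = e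
      · subst hi; simp [heB]
      · simp [mem_symmDiff, hi]
    simp only [h2, neg_one_pow_card, symmDiff_chi, chi_singleton, he, mem_univ, if_true, if_false,
      mul_one, mul_neg_one, neg_mul, sum_neg_distrib] at h1
    simp only [neg_one_pow_card]
    rw [self_eq_neg.1 h1]
    simp
  have h' : ∀ x, (ind F x *
      mean fun y => ind F y * ∑ R, (-1) ^ #R * b (R ∩ B) * chi R (x ∆ y)) = 0 :=
    fun x => by
      rw [← mean_const_mul]
      simp only [h, mean_const]
  simp only [h', mean_const]

/-- The Hoffman-type bound: a cut-agreeing family has little Fourier mass above level three. -/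
theorem CutAgreeing.weight_le {Z F : Finset (Finset α)} (hF : CutAgreeing Z F)
    (hZ : IsCode Z univ) :
    weight (ind F) (fun R => 3 < #R) ≤ 128 * (mean (ind F) * (1 - 8 * mean (ind F))) := by
  set f := ind F
  set μ := mean f with hμ
  let L : Finset α → ℤ := fun R => (-1) ^ #R * ∑ B ∈ Z, cutWeight Z (R ∩ B)
  have h0 : ∑ R, (L R : ℝ) * hat f R ^ 2 = 0 := by
    have e : ∀ R, (L R : ℝ) * hat f R ^ 2 =
        ∑ B ∈ Z, (-1) ^ #R * (cutWeight Z (R ∩ B) : ℝ) * hat f R ^ 2 := fun R => by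
      simp only [L]
      push_cast
      rw [mul_sum, sum_mul]
    simp only [e]
    rw [sum_comm]
    exact Finset.sum_eq_zero fun B hB => hF.sum_eq_zero hB fun R => (cutWeight Z R : ℝ)
  have hZ0 : (0 : ℝ) < #Z := by exact_mod_cast card_pos.2 ⟨∅, hZ.empty_mem⟩
  have hsum : ∑ R, hat f R ^ 2 = μ := by rw [← mean_sq, mean_ind_sq]
  have hL : ∀ R, (#Z : ℝ) * (-8 * hat f R ^ 2 + (if R = ∅ then 64 * μ ^ 2 else 0) +
      (if 3 < #R then hat f R ^ 2 else 0) / 16) ≤ L R * hat f R ^ 2 := by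
    intro R
    have hsq := sq_nonneg (hat f R)
    by_cases hR : R = ∅
    · subst hR
      have : (L ∅ : ℝ) = #Z * 56 := by simp [L, (isCutWeight_cutWeight Z).empty]
      rw [this, hat_empty, ← hμ]
      simp
      apply le_of_eq
      ring
    · obtain ⟨h1, h2⟩ := hZ.cutWeight_bounds (subset_univ R) (nonempty_iff_ne_empty.2 hR)
      have h1' : -8 * (#Z : ℝ) ≤ L R := by exact_mod_cast h1
      rw [if_neg hR]
      split_ifs with h3
      · have h2' : -127 * (#Z : ℝ) ≤ 16 * L R := by exact_mod_cast h2 h3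
        nlinarith [mul_le_mul_of_nonneg_right h2' hsq]
      · nlinarith [mul_le_mul_of_nonneg_right h1' hsq]
  have h1 := sum_le_sum fun R (_ : R ∈ univ) => hL R
  rw [h0, ← mul_sum] at h1
  have h2 := nonpos_of_mul_nonpos_right h1 hZ0
  rw [sum_add_distrib, sum_add_distrib, ← mul_sum, hsum, sum_ite_eq' univ ∅, if_pos (mem_univ _),
    ← sum_div, ← sum_filter] at h2
  unfold weight
  linarith

end CubeFourier

namespace CubeFourier

open Finset LinearCode
open scoped symmDiff

variable {α : Type*} [Fintype α] [DecidableEq α]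

lemma chi_inter_right (R x T : Finset α) : chi R (x ∩ T) = chi (R ∩ T) x := by
  simp only [chi, mem_inter]
  exact prod_congr rfl fun e _ => by congr 1; rw [and_assoc, and_comm (a := e ∈ x)]

/-- The part of the Fourier expansion of `f` supported inside `J`. -/
noncomputable def project (J : Finset α) (f : Finset α → ℝ) (x : Finset α) : ℝ :=
  ∑ R, (if R ⊆ J then hat f R else 0) * chi R x

lemma project_inter (J : Finset α) (f : Finset α → ℝ) (x : Finset α) :
    project J f (x ∩ J) = project J f x := by
  refine sum_congr rfl fun R _ => ?_
  split_ifs with h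
  · rw [chi_inter_right, inter_eq_left.2 h]
  · simp

/-- Projecting onto `J` averages over the coordinates outside `J`. -/
lemma project_eq_mean (J : Finset α) (f : Finset α → ℝ) (x : Finset α) :
    project J f x = mean fun y => f ((x ∩ J) ∆ (y ∩ Jᶜ)) := by
  have h1 : ∀ y, f ((x ∩ J) ∆ (y ∩ Jᶜ)) =
      ∑ R, hat f R * chi R (x ∩ J) * chi (R ∩ Jᶜ) y := fun y => by
    rw [← sum_hat_mul_chi f]
    refine sum_congr rfl fun R _ => ?_
    rw [chi_symmDiff, chi_inter_right R y, mul_assoc]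
  simp only [h1, mean_sum, mean_const_mul, mean_chi]
  refine sum_congr rfl fun R _ => ?_
  have h2 : R ∩ Jᶜ = ∅ ↔ R ⊆ J := by
    rw [← sdiff_eq_inter_compl, sdiff_eq_empty_iff_subset]
  by_cases hR : R ⊆ J
  · rw [if_pos hR, if_pos (h2.2 hR), chi_inter_right, inter_eq_left.2 hR, mul_one]
  · rw [if_neg hR, if_neg fun h => hR (h2.1 h), zero_mul, mul_zero]

lemma mean_sub_project_sq (J : Finset α) (f : Finset α → ℝ) :
    mean (fun x => (f x - project J f x) ^ 2) = weight f fun R => ¬ R ⊆ J := by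
  rw [mean_sq, weight, sum_filter]
  refine sum_congr rfl fun R _ => ?_
  have : hat (project J f) R = if R ⊆ J then hat f R else 0 := hat_sum_mul_chi _ R
  rw [hat_sub, this]
  by_cases h : R ⊆ J <;> simp [h]

/-- Any two members of `F` agree on a set of coordinates with property `P`. -/
def Agreeing (P : Finset α → Prop) (F : Finset (Finset α)) : Prop :=
  ∀ G ∈ F, ∀ H ∈ F, P (G ∆ H)ᶜ

/-- Membership in `F` depends only on the coordinates in `J`. -/
def DependsOn (F : Finset (Finset α)) (J : Finset α) : Prop :=
  ∀ x, x ∩ J ∈ F ↔ x ∈ F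

omit [Fintype α] in
lemma mem_of_one_lt_ind_add_ind {F : Finset (Finset α)} {x y : Finset α}
    (h : 1 < ind F x + ind F y) : x ∈ F ∧ y ∈ F := by
  unfold ind at h
  split_ifs at h with h1 h2
  · exact ⟨h1, h2⟩
  all_goals norm_num at h

/-- An agreeing family with little Fourier mass outside `J` is close to an agreeing family
depending only on `J`. -/
lemma Agreeing.exists_dependsOn {P : Finset α → Prop} (hP : ∀ A B, A ⊆ B → P A → P B)
    {F : Finset (Finset α)} (hF : Agreeing P F) (J : Finset α) :
    ∃ F', Agreeing P F' ∧ DependsOn F' J ∧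
      mean (ind (F ∆ F')) ≤ 4 * weight (ind F) fun R => ¬ R ⊆ J := by
  set g := project J (ind F) with hg
  have hmem : ∀ x, x ∈ univ.filter (fun x => 1 / 2 < g x) ↔ 1 / 2 < g x := fun x => by simp
  refine ⟨univ.filter fun x => 1 / 2 < g x, fun x hx y hy => ?_, fun x => ?_, ?_⟩
  · rw [hmem, hg, project_eq_mean] at hx hy
    rw [← mean_comp_symmDiff _ univ] at hy
    obtain ⟨z, hz⟩ : ∃ z, 1 < ind F ((x ∩ J) ∆ (z ∩ Jᶜ)) +
        ind F ((y ∩ J) ∆ ((z ∆ univ) ∩ Jᶜ)) := by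
      by_contra! hcon
      have h1 := mean_mono hcon
      rw [mean_add, mean_const] at h1
      linarith
    obtain ⟨h1, h2⟩ := mem_of_one_lt_ind_add_ind hz
    refine hP _ _ (fun e he => ?_) (hF _ h1 _ h2)
    simp only [mem_compl, mem_symmDiff, mem_inter, mem_univ] at he ⊢
    tauto
  · rw [hmem, hmem, hg, project_inter]
  · rw [← mean_sub_project_sq, ← mean_const_mul]
    refine mean_mono fun x => ?_
    rw [← hg]
    simp only [ind, mem_symmDiff, hmem]
    by_cases h1 : x ∈ F <;> by_cases h2 : 1 / 2 < g x <;>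
      simp only [h1, h2, not_true_eq_false, not_false_eq_true, and_self, or_self, and_true, or_true,
        or_false, and_false, if_true, if_false] <;> nlinarith

lemma DependsOn.card {F : Finset (Finset α)} {J : Finset α} (h : DependsOn F J) :
    #F = #{A ∈ J.powerset | A ∈ F} * 2 ^ (Fintype.card α - #J) := by
  rw [← card_compl, ← card_powerset, ← card_product]
  refine card_nbij' (fun x => (x ∩ J, x ∩ Jᶜ)) (fun p => p.1 ∪ p.2) (fun x hx => ?_)
    (fun p hp => ?_) (fun x _ => ?_) (fun p hp => ?_)
  · simp [(h x).2 hx]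
  · simp only [coe_product, Set.mem_prod, mem_coe, mem_filter, mem_powerset] at hp ⊢
    rw [← h]
    have : (p.1 ∪ p.2) ∩ J = p.1 := by
      ext e
      have h1 := @hp.1.1 e
      have h2 := @hp.2 e
      simp only [mem_compl, mem_inter, mem_union] at *
      tauto
    rw [this]
    exact hp.1.2
  · ext e
    simp only [mem_compl, mem_inter, mem_union]
    tauto
  · simp only [coe_product, Set.mem_prod, mem_coe, mem_filter, mem_powerset] at hp
    ext e <;> have h1 := @hp.1.1 e <;> have h2 := @hp.2 e <;>
      simp only [mem_compl, mem_inter, mem_union] at * <;> tauto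

lemma DependsOn.mean_mul_two_pow {F : Finset (Finset α)} {J : Finset α} (h : DependsOn F J) :
    mean (ind F) * 2 ^ #J = #{A ∈ J.powerset | A ∈ F} := by
  rw [mean_ind, h.card]
  push_cast
  rw [mul_div_assoc, mul_assoc, div_mul_eq_mul_div, ← pow_add,
    Nat.sub_add_cancel (card_le_univ J), div_self (by positivity), mul_one]

/-- If `R` is maximal in the Fourier support of `h`, then `h` does not vanish on any translate of
the subcube spanned by `R`. -/
lemma exists_ne_zero_of_maximal {h : Finset α → ℝ} {R : Finset α} (hR : hat h R ≠ 0)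
    (hmax : ∀ S, R ⊂ S → hat h S = 0) (x : Finset α) : ∃ y ⊆ R, h (x ∆ y) ≠ 0 := by
  by_contra! hcon
  have h1 : ∀ y, h (x ∆ (y ∩ R)) * chi R y = ∑ S, hat h S * chi S x * chi ((S ∩ R) ∆ R) y :=
    fun y => by
      rw [← sum_hat_mul_chi h, sum_mul]
      refine sum_congr rfl fun S _ => ?_
      rw [chi_symmDiff, chi_inter_right, symmDiff_chi]
      ring
  have h2 : (mean fun y => h (x ∆ (y ∩ R)) * chi R y) = 0 := by
    simp only [hcon _ inter_subset_right, zero_mul, mean_const]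
  simp only [h1, mean_sum, mean_const_mul, mean_chi, symmDiff_eq_empty_iff] at h2
  rw [sum_eq_single R] at h2
  · rw [if_pos (inter_self R), mul_one] at h2
    have := chi_mul_self R x
    rcases mul_eq_zero.1 h2 with h3 | h3
    · exact hR h3
    · rw [h3] at this; norm_num at this
  · intro S _ hS
    split_ifs with h3
    · rw [hmax S (ssubset_of_subset_of_ne (inter_eq_right.1 h3) hS.symm)]
      simp
    · simp
  · simp

omit [Fintype α] in
lemma oddPart_symmDiff_singleton (i : α) (f : Finset α → ℝ) (x : Finset α) :
    oddPart i f (x ∆ {i}) = -oddPart i f x := by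
  unfold oddPart
  rw [symmDiff_symmDiff_cancel_right]
  ring

/-- A relevant coordinate of a degree-three Boolean function has large influence. -/
lemma le_mean_oddPart_sq {F : Finset (Finset α)} (hdeg : DegreeLE (ind F) 3) {i : α}
    {R₀ : Finset α} (hi : i ∈ R₀) (hR₀ : hat (ind F) R₀ ≠ 0) :
    1 / 16 ≤ mean fun x => oddPart i (ind F) x ^ 2 := by
  obtain ⟨R, hR, hmax⟩ := exists_max_image
    (univ.filter fun R : Finset α => i ∈ R ∧ hat (ind F) R ≠ 0) card ⟨R₀, by simp [hi, hR₀]⟩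
  simp only [mem_filter, mem_univ, true_and] at hR hmax
  have hR3 : #R ≤ 3 := not_lt.1 fun h => hR.2 (hdeg R h)
  set h := oddPart i (ind F) with hh
  have hhR : hat h R ≠ 0 := by rw [hh, hat_oddPart, if_pos hR.1]; exact hR.2
  have hhS : ∀ S, R ⊂ S → hat h S = 0 := by
    intro S hS
    rw [hh, hat_oddPart, if_pos (hS.1 hR.1)]
    by_contra hne
    exact (card_lt_card hS).not_ge (hmax S ⟨hS.1 hR.1, hne⟩)
  have hval : ∀ x, h x ≠ 0 → h x ^ 2 = 1 / 4 := by
    intro x hx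
    simp only [hh, oddPart] at hx ⊢
    rcases ind_eq_zero_or_one F x with h1 | h1 <;>
      rcases ind_eq_zero_or_one F (x ∆ {i}) with h2 | h2 <;>
      rw [h1, h2] at hx ⊢ <;> norm_num at hx <;> norm_num
  have hpt : ∀ x, 1 / 4 ≤ ∑ y ∈ (R.erase i).powerset, h (x ∆ y) ^ 2 := by
    intro x
    obtain ⟨y, hy, hxy⟩ := exists_ne_zero_of_maximal hhR hhS x
    have key : ∀ z ∈ (R.erase i).powerset, h (x ∆ z) ≠ 0 →
        1 / 4 ≤ ∑ y ∈ (R.erase i).powerset, h (x ∆ y) ^ 2 := fun z hz hxz => by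
      rw [← hval _ hxz]
      exact single_le_sum (f := fun y => h (x ∆ y) ^ 2) (fun y _ => sq_nonneg _) hz
    by_cases hiy : i ∈ y
    · refine key (y ∆ {i}) (mem_powerset.2 fun e he => ?_) ?_
      · rw [mem_symmDiff, mem_singleton] at he
        rw [mem_erase]
        rcases he with he | he
        · exact ⟨he.2, hy he.1⟩
        · exact absurd (he.1 ▸ hiy) he.2
      · rw [← symmDiff_assoc, hh, oddPart_symmDiff_singleton, neg_ne_zero]
        exact hxy
    · exact key y (mem_powerset.2 (subset_erase.2 ⟨hy, hiy⟩)) hxy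
  have h1 := mean_mono hpt
  rw [mean_const, mean_sum] at h1
  have h2 : ∀ y, (mean fun x => h (x ∆ y) ^ 2) = mean fun x => h x ^ 2 :=
    fun y => mean_comp_symmDiff (fun x => h x ^ 2) y
  simp only [h2, sum_const, card_powerset, nsmul_eq_mul, card_erase_of_mem hR.1] at h1
  have h3 : ((2 ^ (#R - 1) : ℕ) : ℝ) ≤ 2 ^ 2 := by
    exact_mod_cast Nat.pow_le_pow_right (by norm_num) (by omega)
  have h4 : 0 ≤ mean fun x => h x ^ 2 := mean_nonneg fun x => sq_nonneg _
  nlinarith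

end CubeFourier

namespace CubeFourier

open Finset LinearCode
open scoped symmDiff

variable {α : Type*} [Fintype α] [DecidableEq α]

lemma Agreeing.cutAgreeing {P : Finset α → Prop} {F : Finset (Finset α)} (hF : Agreeing P F)
    {Z : Finset (Finset α)} (hP : ∀ A, P A → ∀ B ∈ Z, ∃ e ∈ A, e ∉ B) : CutAgreeing Z F :=
  fun G hG H hH B hB => by
    obtain ⟨e, he, heB⟩ := hP _ (hF G hG H hH) B hB
    exact ⟨e, mem_compl.1 he, heB⟩

/-- `Tri` is the collection of minimal sets with the monotone property `P`, in a setting modelled on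
odd cycles: they are three-element sets, any two of which share at most one element. -/
structure IsTriangleLike (P Tri : Finset α → Prop) : Prop where
  mono : ∀ A B, A ⊆ B → P A → P B
  three_le : ∀ A, P A → 3 ≤ #A
  tri : ∀ A, P A → #A = 3 → Tri A
  eq_of_inter : ∀ A B, Tri A → Tri B → 2 ≤ #(A ∩ B) → A = B

/-- The coordinates on which a Boolean function really depends. -/
noncomputable def relevant (f : Finset α → ℝ) : Finset α :=
  univ.filter fun i => ∃ R, i ∈ R ∧ hat f R ≠ 0

lemma subset_relevant {f : Finset α → ℝ} {R : Finset α} (h : hat f R ≠ 0) : R ⊆ relevant f :=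
  fun i hi => by
    simp only [relevant, mem_filter, mem_univ, true_and]
    exact ⟨R, hi, h⟩

omit [Fintype α] in
lemma ind_eq_ind_iff {F : Finset (Finset α)} {x y : Finset α} :
    ind F x = ind F y ↔ (x ∈ F ↔ y ∈ F) := by
  unfold ind
  by_cases hx : x ∈ F <;> by_cases hy : y ∈ F <;> simp [hx, hy]

lemma dependsOn_relevant (F : Finset (Finset α)) : DependsOn F (relevant (ind F)) := fun x => by
  have h : ind F (x ∩ relevant (ind F)) = ind F x := by
    rw [← sum_hat_mul_chi (ind F), ← sum_hat_mul_chi (ind F) x]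
    refine sum_congr rfl fun R _ => ?_
    by_cases hR : hat (ind F) R = 0
    · rw [hR, zero_mul, zero_mul]
    · rw [chi_inter_right, inter_eq_left.2 (subset_relevant hR)]
  exact ind_eq_ind_iff.1 h

section Degree

variable {F : Finset (Finset α)} (hdeg : DegreeLE (ind F) 3) (hμ : mean (ind F) = 1 / 8)
include hdeg hμ

lemma mean_oddPart_sq_eq {i : α} (hi : i ∈ relevant (ind F)) :
    (mean fun x => oddPart i (ind F) x ^ 2) = 1 / 16 ∧ ∀ x ∈ F, x ∆ {i} ∉ F := by
  simp only [relevant, mem_filter, mem_univ, true_and] at hi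
  obtain ⟨R, hiR, hR⟩ := hi
  have h1 := le_mean_oddPart_sq hdeg hiR hR
  have h2 : ∀ x, oddPart i (ind F) x ^ 2 = 1 / 4 * (ind F x + ind F (x ∆ {i})) -
      1 / 2 * (ind F x * ind F (x ∆ {i})) := fun x => by
    unfold oddPart
    rcases ind_eq_zero_or_one F x with h | h <;>
      rcases ind_eq_zero_or_one F (x ∆ {i}) with h' | h' <;> rw [h, h'] <;> norm_num
  have h3 : 0 ≤ mean fun x => ind F x * ind F (x ∆ {i}) := mean_nonneg fun x =>
    mul_nonneg (by unfold ind; split_ifs <;> norm_num) (by unfold ind; split_ifs <;> norm_num)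
  have h4 : (mean fun x => oddPart i (ind F) x ^ 2) =
      1 / 16 - 1 / 2 * mean fun x => ind F x * ind F (x ∆ {i}) := by
    simp only [h2]
    rw [mean_sub, mean_const_mul, mean_const_mul, mean_add, mean_comp_symmDiff, hμ]
    norm_num
  have h5 : (mean fun x => ind F x * ind F (x ∆ {i})) = 0 := by linarith
  refine ⟨by rw [h4, h5]; norm_num, fun x hx hx' => ?_⟩
  unfold mean at h5
  rw [div_eq_zero_iff, or_iff_left (by positivity), sum_eq_zero_iff_of_nonneg fun x _ =>
    mul_nonneg (by unfold ind; split_ifs <;> norm_num) (by unfold ind; split_ifs <;> norm_num)]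
    at h5
  have := h5 x (mem_univ x)
  simp [ind, hx, hx'] at this

lemma card_relevant_le : #(relevant (ind F)) ≤ 5 := by
  set f := ind F
  set L := relevant f
  have h1 : ∑ i ∈ L, (mean fun x => oddPart i f x ^ 2) = #L * (1 / 16) := by
    rw [sum_congr rfl fun i hi => (mean_oddPart_sq_eq hdeg hμ hi).1]
    rw [sum_const, nsmul_eq_mul]
  have h2 : ∑ i ∈ L, (mean fun x => oddPart i f x ^ 2) ≤
      ∑ R, (3 * hat f R ^ 2 - if R = ∅ then 3 * hat f R ^ 2 else 0) := by
    simp only [mean_sq, hat_oddPart]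
    rw [sum_comm]
    refine sum_le_sum fun R _ => ?_
    have e : ∀ i, (if i ∈ R then hat f R else 0) ^ 2 = if i ∈ R then hat f R ^ 2 else 0 :=
      fun i => by split_ifs <;> simp
    simp only [e]
    rw [← sum_filter, sum_const, nsmul_eq_mul]
    by_cases hR0 : R = ∅
    · simp [hR0]
    rw [if_neg hR0, sub_zero]
    by_cases hR : 3 < #R
    · simp [hdeg R hR]
    · gcongr
      have : #{i ∈ L | i ∈ R} ≤ #R := card_le_card fun i hi => (mem_filter.1 hi).2
      exact_mod_cast this.trans (not_lt.1 hR)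
  rw [sum_sub_distrib, ← mul_sum, ← mean_sq, mean_ind_sq, sum_ite_eq' univ ∅, if_pos (mem_univ _),
    hat_empty, hμ, h1] at h2
  have h3 : (#L : ℝ) < 6 := by linarith
  have h4 : #L < 6 := by exact_mod_cast h3
  omega

/-- An agreeing family of measure `1 / 8` and degree three is a triangle junta. -/
theorem Agreeing.exists_junta {P Tri : Finset α → Prop} (hP : IsTriangleLike P Tri)
    (hF : Agreeing P F) :
    ∃ T S, Tri T ∧ S ⊆ T ∧ ∀ x, x ∈ F ↔ x ∩ T = S := by
  set L := relevant (ind F)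
  have hL := dependsOn_relevant F
  have hagree : ∀ A ∈ F, ∀ B ∈ F, P (L \ (A ∆ B)) := by
    intro A hA B hB
    have hB' : (B ∩ L) ∪ (Aᶜ \ L) ∈ F := by
      rw [← hL]
      convert (hL B).2 hB using 1
      ext e
      simp only [mem_inter, mem_union, mem_sdiff]
      tauto
    refine hP.mono _ _ (fun e he => ?_) (hF A hA _ hB')
    simp only [mem_compl, mem_symmDiff, mem_inter, mem_union, mem_sdiff] at he ⊢
    tauto
  have hcard : 8 * #{A ∈ L.powerset | A ∈ F} = 2 ^ #L := by
    have := hL.mean_mul_two_pow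
    rw [hμ] at this
    have h' : 8 * (#{A ∈ L.powerset | A ∈ F} : ℝ) = 2 ^ #L := by rw [← this]; ring
    exact_mod_cast h'
  set Q := {A ∈ L.powerset | A ∈ F}
  have hQ : ∀ A ∈ Q, A ⊆ L ∧ A ∈ F := fun A hA => by simpa [Q] using hA
  have hdist : ∀ A ∈ Q, ∀ B ∈ Q, A ≠ B → 2 ≤ #(A ∆ B) ∧ A ∆ B ⊆ L := by
    intro A hA B hB hne
    have hsub : A ∆ B ⊆ L := fun e he => by
      rcases mem_symmDiff.1 he with h | h
      · exact (hQ A hA).1 h.1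
      · exact (hQ B hB).1 h.1
    refine ⟨?_, hsub⟩
    by_contra! hlt
    have h0 : #(A ∆ B) ≠ 0 := fun h0 => hne ((symmDiff_eq_empty_iff A B).1 (card_eq_zero.1 h0))
    obtain ⟨i, hi⟩ := card_eq_one.1 (show #(A ∆ B) = 1 by omega)
    have hiL : i ∈ L := hsub (by simp [hi])
    refine (mean_oddPart_sq_eq hdeg hμ hiL).2 A (hQ A hA).2 ?_
    rw [← hi, symmDiff_symmDiff_cancel_left]
    exact (hQ B hB).2
  have hk5 := card_relevant_le hdeg hμ
  have hk3 : 3 ≤ #L := by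
    by_contra! hlt
    interval_cases #L <;> omega
  have hagree' : ∀ A ∈ Q, ∀ B ∈ Q, P (L \ (A ∆ B)) := fun A hA B hB =>
    hagree A (hQ A hA).2 B (hQ B hB).2
  have hdiff : ∀ A ∈ Q, ∀ B ∈ Q, A ≠ B → #(L \ (A ∆ B)) = #L - #(A ∆ B) ∧ 3 ≤ #(L \ (A ∆ B)) :=
    fun A hA B hB hne => ⟨card_sdiff_of_subset (hdist A hA B hB hne).2,
      hP.three_le _ (hagree' A hA B hB)⟩
  change #L ≤ 5 at hk5
  obtain h3 | h4 | h5 : #L = 3 ∨ #L = 4 ∨ #L = 5 := by omega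
  · rw [h3] at hcard
    obtain ⟨S, hS⟩ := card_eq_one.1 (show #Q = 1 by omega)
    have hSQ : S ∈ Q := by simp [hS]
    refine ⟨L, S, hP.tri L ?_ h3, (hQ S hSQ).1, fun x => ?_⟩
    · simpa using hagree' S hSQ S hSQ
    · rw [← hL, ← mem_singleton, ← hS]
      simp only [Q, mem_filter, mem_powerset, inter_subset_right, true_and]
      rfl
  · exfalso
    rw [h4] at hcard
    obtain ⟨A, B, hne, hAB⟩ := card_eq_two.1 (show #Q = 2 by omega)
    have hA : A ∈ Q := by simp [hAB]
    have hB : B ∈ Q := by simp [hAB]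
    have := hdist A hA B hB hne
    have := hdiff A hA B hB hne
    omega
  · exfalso
    rw [h5] at hcard
    obtain ⟨A, hA, B, hB, C, hC, hAB, hAC, hBC⟩ := two_lt_card.1 (show 2 < #Q by omega)
    have h1 := hdist A hA B hB hAB
    have h2 := hdist A hA C hC hAC
    have h3 := hdist B hB C hC hBC
    have h1' := hdiff A hA B hB hAB
    have h2' := hdiff A hA C hC hAC
    have h3' := hdiff B hB C hC hBC
    have hun : #((A ∆ B) ∪ (A ∆ C)) ≤ 3 := by
      have e1 := card_union_add_card_inter (A ∆ B) (A ∆ C)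
      have e2 : B ∆ C ⊆ ((A ∆ B) ∪ (A ∆ C)) \ ((A ∆ B) ∩ (A ∆ C)) := fun e he => by
        simp only [mem_symmDiff, mem_union, mem_inter, mem_sdiff] at he ⊢
        tauto
      have e3 : ((A ∆ B) ∪ (A ∆ C)) \ ((A ∆ B) ∩ (A ∆ C)) ⊆ B ∆ C := fun e he => by
        simp only [mem_symmDiff, mem_union, mem_inter, mem_sdiff] at he ⊢
        tauto
      have e4 := congrArg card (e3.antisymm e2)
      rw [card_sdiff_of_subset (inter_subset_left.trans subset_union_left)] at e4
      omega
    have heq := hP.eq_of_inter _ _ (hP.tri _ (hagree' A hA B hB) (by omega))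
      (hP.tri _ (hagree' A hA C hC) (by omega)) (by
        rw [← sdiff_union_distrib, card_sdiff_of_subset (union_subset h1.2 h2.2)]
        omega)
    have : A ∆ B = A ∆ C := by
      rw [← Finset.sdiff_sdiff_eq_self h1.2, heq, Finset.sdiff_sdiff_eq_self h2.2]
    exact hBC (symmDiff_right_injective A this)

end Degree

end CubeFourier

namespace CubeFourier

open Finset LinearCode
open scoped symmDiff

variable {α : Type*} [Fintype α] [DecidableEq α]

lemma weight_nonneg (f : Finset α → ℝ) (p : Finset α → Prop) [DecidablePred p] :
    0 ≤ weight f p :=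
  sum_nonneg fun R _ => sq_nonneg (hat f R)

lemma mean_ind_sub_le (F F' : Finset (Finset α)) :
    mean (ind F) - mean (ind F') ≤ mean (ind (F ∆ F')) := by
  rw [← mean_sub]
  refine mean_mono fun x => ?_
  by_cases h : x ∈ F <;> by_cases h' : x ∈ F' <;> simp [ind, h, h', mem_symmDiff]

lemma CutAgreeing.mean_le {Z F : Finset (Finset α)} (hF : CutAgreeing Z F) (hZ : IsCode Z univ) :
    mean (ind F) ≤ 1 / 8 := by
  have h := (weight_nonneg (ind F) _).trans (hF.weight_le hZ)
  have h0 : 0 ≤ mean (ind F) := mean_ind_sq F ▸ mean_nonneg fun x => sq_nonneg _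
  nlinarith

lemma CutAgreeing.degreeLE {Z F : Finset (Finset α)} (hF : CutAgreeing Z F) (hZ : IsCode Z univ)
    (hμ : mean (ind F) = 1 / 8) : DegreeLE (ind F) 3 := fun R hR => by
  have h := hF.weight_le hZ
  rw [hμ] at h
  have h0 : weight (ind F) (fun R => 3 < #R) = 0 :=
    le_antisymm (by linarith) (weight_nonneg _ _)
  rw [weight, sum_eq_zero_iff_of_nonneg fun R _ => sq_nonneg _] at h0
  exact pow_eq_zero_iff two_ne_zero |>.1 (h0 R (by simp [hR]))

lemma DependsOn.le_mean {F : Finset (Finset α)} {J : Finset α} (h : DependsOn F J)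
    (hlt : 2 ^ #J * (1 - 8 * mean (ind F)) < 1) : 1 / 8 ≤ mean (ind F) := by
  by_contra! hμ
  have hN := h.mean_mul_two_pow
  have h1 : 8 * (#{A ∈ J.powerset | A ∈ F} : ℝ) < 2 ^ #J := by
    rw [← hN]
    have : (0 : ℝ) < 2 ^ #J := by positivity
    nlinarith
  have h2 : 8 * #{A ∈ J.powerset | A ∈ F} + 1 ≤ 2 ^ #J := by exact_mod_cast h1
  have h3 : 8 * (#{A ∈ J.powerset | A ∈ F} : ℝ) + 1 ≤ 2 ^ #J := by exact_mod_cast h2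
  rw [← hN] at h3
  linarith

/-- Stability for agreeing families whose measure is very close to `1 / 8`. -/
lemma Agreeing.exists_junta_of_le_mean {P Tri : Finset α → Prop} (hP : IsTriangleLike P Tri)
    {Z F : Finset (Finset α)} (hZ : IsCode Z univ) (hPZ : ∀ A, P A → ∀ B ∈ Z, ∃ e ∈ A, e ∉ B)
    (hF : Agreeing P F) {ε : ℝ} (hμ : 1 / 8 - ε ≤ mean (ind F))
    (hε : 256 * 9 ^ 10 * (128 * ε) ≤ 1)
    (hε' : 2 ^ (8 * 9 ^ 3 * 3) * (8 * (ε + 4 * ((1 + 24 * 9 ^ 7) * (128 * ε)))) < 1) :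
    ∃ T S, Tri T ∧ S ⊆ T ∧
      mean (ind (F ∆ univ.filter fun x => x ∩ T = S)) ≤ 4 * ((1 + 24 * 9 ^ 7) * (128 * ε)) := by
  have hcut := hF.cutAgreeing hPZ
  have hle := hcut.mean_le hZ
  have h0 : 0 ≤ mean (ind F) := mean_ind_sq F ▸ mean_nonneg fun x => sq_nonneg _
  have hw : weight (ind F) (fun R => 3 < #R) ≤ 128 * ε := by
    refine (hcut.weight_le hZ).trans ?_
    nlinarith
  obtain ⟨J, hJ, hwJ⟩ := exists_junta_of_weight_le (ind_eq_zero_or_one F) hw hε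
  obtain ⟨F', hF', hdep, hdist⟩ := hF.exists_dependsOn hP.mono J
  have hwJ' : weight (ind F) (fun R => ¬ R ⊆ J) ≤ (1 + 24 * 9 ^ 7) * (128 * ε) := by
    refine hwJ.trans_eq ?_
    norm_num
  have hdist' : mean (ind (F ∆ F')) ≤ 4 * ((1 + 24 * 9 ^ 7) * (128 * ε)) :=
    hdist.trans (by gcongr)
  have hsub := mean_ind_sub_le F F'
  have hcut' := hF'.cutAgreeing hPZ
  have hle' := hcut'.mean_le hZ
  have hge' : 1 / 8 ≤ mean (ind F') := by
    refine hdep.le_mean (lt_of_le_of_lt ?_ hε')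
    refine mul_le_mul (pow_le_pow_right₀ one_le_two hJ) ?_ ?_ (by positivity) <;> linarith
  have hμ' := le_antisymm hle' hge'
  obtain ⟨T, S, hT, hST, hmem⟩ := hF'.exists_junta (hcut'.degreeLE hZ hμ') hμ' hP
  refine ⟨T, S, hT, hST, ?_⟩
  have : (univ.filter fun x => x ∩ T = S) = F' := by
    ext x
    simp [hmem]
  rwa [this]

end CubeFourier

section Graph

open Finset SimpleGraph

variable {n : ℕ}

lemma HasOddCycle.mono {G H : Finset (Sym2 (Fin n))} (h : HasOddCycle G) (hGH : G ⊆ H) :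
    HasOddCycle H := by
  obtain ⟨v, w, hw, hodd⟩ := h
  have hle : graphOf G ≤ graphOf H := fromEdgeSet_mono (coe_subset.2 hGH)
  exact ⟨v, w.mapLe hle, (Walk.isCycle_mapLe hle).2 hw, by rwa [Walk.length_mapLe]⟩

lemma edges_toFinset_subset {G : Finset (Sym2 (Fin n))} {u v : Fin n} (w : (graphOf G).Walk u v) :
    w.edges.toFinset ⊆ G := fun e he => by
  have := w.edges_subset_edgeSet (List.mem_toFinset.1 he)
  rw [graphOf, edgeSet_fromEdgeSet] at this
  exact mem_coe.1 this.1

lemma HasOddCycle.three_le_card {G : Finset (Sym2 (Fin n))} (h : HasOddCycle G) : 3 ≤ #G := by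
  obtain ⟨v, w, hw, -⟩ := h
  calc 3 ≤ w.length := hw.three_le_length
    _ = #w.edges.toFinset := by
      rw [List.toFinset_card_of_nodup hw.edges_nodup, Walk.length_edges]
    _ ≤ #G := card_le_card (edges_toFinset_subset w)

lemma HasOddCycle.isTriangle {G : Finset (Sym2 (Fin n))} (h : HasOddCycle G) (hG : #G = 3) :
    IsTriangle G := by
  obtain ⟨v, w, hw, -⟩ := h
  have hcard : #w.edges.toFinset = w.length := by
    rw [List.toFinset_card_of_nodup hw.edges_nodup, Walk.length_edges]
  have hle := card_le_card (edges_toFinset_subset w)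
  have h3 := hw.three_le_length
  have heq := eq_of_subset_of_card_le (edges_toFinset_subset w) (by omega)
  have hlen : w.length = 3 := by omega
  rw [← heq]
  clear hcard hle h3 heq hw
  match w, hlen with
  | .cons (v := a) h1 (.cons (v := b) h2 (.cons h3 .nil)), _ =>
    refine ⟨v, a, b, h1.ne, h3.ne.symm, h2.ne, ?_⟩
    ext e
    simp only [Walk.edges_cons, Walk.edges_nil, List.mem_toFinset, List.mem_cons, mem_insert,
      mem_singleton, List.not_mem_nil, or_false, Sym2.eq_swap (a := b) (b := v)]
    tauto

/-- A triangle consists of all edges within a set of three vertices. -/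
lemma IsTriangle.exists_card_eq_three {T : Finset (Sym2 (Fin n))} (hT : IsTriangle T) :
    ∃ V : Finset (Fin n), #V = 3 ∧ ∀ e, e ∈ T ↔ ¬ e.IsDiag ∧ ∀ x ∈ e, x ∈ V := by
  obtain ⟨a, b, c, hab, hac, hbc, rfl⟩ := hT
  refine ⟨{a, b, c}, card_eq_three.2 ⟨a, b, c, hab, hac, hbc, rfl⟩, fun e => ?_⟩
  induction e with
  | _ x y =>
    simp only [mem_insert, mem_singleton, Sym2.eq_iff, Sym2.mk_isDiag_iff, Sym2.mem_iff,
      forall_eq_or_imp, forall_eq]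
    grind

lemma IsTriangle.eq_of_two_le_card_inter {T T' : Finset (Sym2 (Fin n))} (hT : IsTriangle T)
    (hT' : IsTriangle T') (h : 2 ≤ #(T ∩ T')) : T = T' := by
  obtain ⟨V, hV, hTV⟩ := hT.exists_card_eq_three
  obtain ⟨V', hV', hTV'⟩ := hT'.exists_card_eq_three
  obtain ⟨e, he, f, hf, hef⟩ := one_lt_card.1 h
  rw [mem_inter, hTV, hTV'] at he hf
  have hsub : ∀ W : Finset (Fin n), (∀ x ∈ e, x ∈ W) → (∀ x ∈ f, x ∈ W) → #W = 3 →
      e.toFinset ∪ f.toFinset = W := fun W heW hfW hW => by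
    refine eq_of_subset_of_card_le (union_subset (fun x hx => heW x (Sym2.mem_toFinset.1 hx))
      fun x hx => hfW x (Sym2.mem_toFinset.1 hx)) ?_
    by_contra! hlt
    have he2 := Sym2.card_toFinset_of_not_isDiag e he.1.1
    have hf2 := Sym2.card_toFinset_of_not_isDiag f hf.1.1
    have h1 := eq_of_subset_of_card_le (s := e.toFinset) (t := e.toFinset ∪ f.toFinset)
      subset_union_left (by omega)
    have h2 := eq_of_subset_of_card_le (s := f.toFinset) (t := e.toFinset ∪ f.toFinset)
      subset_union_right (by omega)
    refine hef (Sym2.ext fun x => ?_)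
    rw [← Sym2.mem_toFinset, ← Sym2.mem_toFinset, h1, ← h2]
  have hVV : V = V' :=
    (hsub V he.1.2 hf.1.2 hV).symm.trans (hsub V' he.2.2 hf.2.2 hV')
  ext g
  rw [hTV, hTV', hVV]

/-- An odd cycle contains a monochromatic edge for every two-colouring of the vertices. -/
lemma HasOddCycle.exists_isDiag_map {G : Finset (Sym2 (Fin n))} (h : HasOddCycle G)
    (y : Fin n → Bool) : ∃ e ∈ G, (e.map y).IsDiag := by
  obtain ⟨v, w, -, hodd⟩ := h
  by_contra! hcon
  have c : (graphOf G).Coloring Bool := Coloring.mk y fun {a b} hab => by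
    rw [graphOf, fromEdgeSet_adj] at hab
    simpa using hcon _ hab.1
  rw [c.odd_length_iff_not_congr w] at hodd
  tauto

/-- The edges of the complete graph as a type. -/
abbrev CompleteEdge (n : ℕ) : Type := {e : Sym2 (Fin n) // ¬ e.IsDiag}

/-- The set of edges cut by a two-colouring of the vertices. -/
def cut (y : Fin n → Bool) : Finset (CompleteEdge n) :=
  univ.filter fun e => ¬ (e.1.map y).IsDiag

lemma isCode_cut : LinearCode.IsCode (univ.image (cut (n := n))) univ where
  subset A _ := subset_univ A
  empty_mem := mem_image.2 ⟨fun _ => false, mem_univ _, by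
    ext ⟨e, he⟩
    induction e with
    | _ a b => simp [cut]⟩
  symmDiff_mem A hA B hB := by
    obtain ⟨y, -, rfl⟩ := mem_image.1 hA
    obtain ⟨z, -, rfl⟩ := mem_image.1 hB
    refine mem_image.2 ⟨fun i => xor (y i) (z i), mem_univ _, ?_⟩
    ext ⟨e, he⟩
    induction e with
    | _ a b =>
      simp only [cut, mem_filter, mem_univ, true_and, mem_symmDiff, Sym2.map_mk,
        Sym2.mk_isDiag_iff]
      cases y a <;> cases y b <;> cases z a <;> cases z b <;> simp
  exists_mem e _ := by
    obtain ⟨e, he⟩ := e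
    induction e with
    | _ a b =>
      refine ⟨cut fun i => decide (i = a), mem_image_of_mem _ (mem_univ _), ?_⟩
      simpa [cut, eq_comm] using he
  exists_separating e _ f _ hef := by
    obtain ⟨x, hx⟩ : ∃ x, ¬ (x ∈ e.1 ↔ x ∈ f.1) := by
      by_contra! hcon
      exact hef (Subtype.ext (Sym2.ext hcon))
    have hmem : ∀ g : CompleteEdge n, g ∈ cut (fun i => decide (i = x)) ↔ x ∈ g.1 := by
      rintro ⟨g, hg⟩
      induction g with
      | _ a b =>
        simp only [Sym2.mk_isDiag_iff] at hg
        simp only [cut, mem_filter, mem_univ, true_and, Sym2.map_mk, Sym2.mk_isDiag_iff,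
          Sym2.mem_iff, decide_eq_decide]
        grind
    exact ⟨_, mem_image_of_mem _ (mem_univ _), by rwa [hmem, hmem]⟩

/-- The set of unordered pairs underlying a set of edges. -/
def toGraph (A : Finset (CompleteEdge n)) : Finset (Sym2 (Fin n)) :=
  A.map (Function.Embedding.subtype _)

lemma isTriangleLike_toGraph : CubeFourier.IsTriangleLike
    (fun A : Finset (CompleteEdge n) => HasOddCycle (toGraph A))
    fun A => IsTriangle (toGraph A) where
  mono A B hAB h := h.mono (map_subset_map.2 hAB)
  three_le A h := by simpa [toGraph] using h.three_le_card
  tri A h hA := h.isTriangle (by simpa [toGraph] using hA)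
  eq_of_inter A B hA hB h := by
    refine map_injective (Function.Embedding.subtype _) (hA.eq_of_two_le_card_inter hB ?_)
    simpa only [toGraph, ← map_inter, card_map] using h

lemma exists_notMem_cut (A : Finset (CompleteEdge n)) (hA : HasOddCycle (toGraph A)) :
    ∀ B ∈ univ.image (cut (n := n)), ∃ e ∈ A, e ∉ B := by
  intro B hB
  obtain ⟨y, -, rfl⟩ := mem_image.1 hB
  obtain ⟨e, he, hdiag⟩ := hA.exists_isDiag_map y
  obtain ⟨e', he', rfl⟩ := mem_map.1 he
  exact ⟨e', he', by simpa [cut] using hdiag⟩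

@[simp]
lemma mem_toGraph {A : Finset (CompleteEdge n)} {e : Sym2 (Fin n)} :
    e ∈ toGraph A ↔ ∃ h : ¬ e.IsDiag, ⟨e, h⟩ ∈ A := by
  simp [toGraph]

lemma mem_edgeFinset {e : Sym2 (Fin n)} : e ∈ edgeFinset n ↔ ¬ e.IsDiag := by
  simp [_root_.edgeFinset]

lemma toGraph_injective : Function.Injective (toGraph (n := n)) :=
  map_injective _

lemma toGraph_subset (A : Finset (CompleteEdge n)) : toGraph A ⊆ edgeFinset n := fun _ he =>
  mem_edgeFinset.2 (mem_toGraph.1 he).1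

/-- A family of graphs as a family of sets of edges of the complete graph. -/
def edgeFamily (F : Finset (Finset (Sym2 (Fin n)))) : Finset (Finset (CompleteEdge n)) :=
  univ.filter fun A => toGraph A ∈ F

lemma mem_edgeFamily {F : Finset (Finset (Sym2 (Fin n)))} {A : Finset (CompleteEdge n)} :
    A ∈ edgeFamily F ↔ toGraph A ∈ F := by
  simp [edgeFamily]

lemma muFam_eq_mean {F : Finset (Finset (Sym2 (Fin n)))} (hF : F ⊆ (edgeFinset n).powerset) :
    muFam n F = CubeFourier.mean (CubeFourier.ind (edgeFamily F)) := by
  have hcard : #(edgeFamily F) = #F := by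
    refine card_bij (fun A _ => toGraph A) (fun A hA => mem_edgeFamily.1 hA)
      (fun A _ B _ h => toGraph_injective h) fun G hG => ?_
    have h : toGraph (G.subtype fun e => ¬ e.IsDiag) = G :=
      subtype_map_of_mem fun _ he => mem_edgeFinset.1 (mem_powerset.1 (hF hG) he)
    exact ⟨_, mem_edgeFamily.2 (h.symm ▸ hG), h⟩
  rw [CubeFourier.mean_ind, hcard, muFam, Sym2.card_subtype_not_diag, Fintype.card_fin]

lemma OddCycleAgreeing.agreeing_edgeFamily {F : Finset (Finset (Sym2 (Fin n)))}
    (hF : OddCycleAgreeing n F) :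
    CubeFourier.Agreeing (fun A => HasOddCycle (toGraph A)) (edgeFamily F) := fun A hA B hB => by
  convert hF _ (mem_edgeFamily.1 hA) _ (mem_edgeFamily.1 hB) using 1
  ext e
  by_cases he : e.IsDiag <;> simp [mem_edgeFinset, he, iff_def]

lemma muFam_le_one {F : Finset (Finset (Sym2 (Fin n)))} (hF : F ⊆ (edgeFinset n).powerset) :
    muFam n F ≤ 1 := by
  rw [muFam_eq_mean hF, ← CubeFourier.mean_const (α := CompleteEdge n) 1]
  refine CubeFourier.mean_mono fun x => ?_
  rcases CubeFourier.ind_eq_zero_or_one (edgeFamily F) x with h | h <;> norm_num [h]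

end Graph

open scoped symmDiff in
lemma edgeFamily_symmDiff_junta {n : ℕ} (F : Finset (Finset (Sym2 (Fin n))))
    (T S : Finset (CompleteEdge n)) :
    edgeFamily ((F \ (edgeFinset n).powerset.filter (fun G => G ∩ toGraph T = toGraph S)) ∪
      ((edgeFinset n).powerset.filter (fun G => G ∩ toGraph T = toGraph S) \ F)) =
      edgeFamily F ∆ Finset.univ.filter fun A => A ∩ T = S := by
  ext A
  have h : toGraph A ∩ toGraph T = toGraph S ↔ A ∩ T = S := by
    rw [← toGraph_injective.eq_iff, toGraph, toGraph, toGraph, toGraph, Finset.map_inter]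
  simp [mem_edgeFamily, Finset.mem_symmDiff, h, toGraph_subset]

theorem odd_cycle_agreeing_stability :
    ∃ c : ℝ, 0 < c ∧
      ∀ (n : ℕ), 3 ≤ n → ∀ ε : ℝ, 0 ≤ ε →
        ∀ F : Finset (Finset (Sym2 (Fin n))),
          F ⊆ (edgeFinset n).powerset →
          OddCycleAgreeing n F →
          muFam n F ≥ 1 / 8 - ε →
          ∃ T S : Finset (Sym2 (Fin n)), IsTriangle T ∧ S ⊆ T ∧
            muFam n
              ((F \ (edgeFinset n).powerset.filter (fun G => G ∩ T = S)) ∪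
                ((edgeFinset n).powerset.filter (fun G => G ∩ T = S) \ F))
              ≤ c * ε := by
  obtain ⟨M, hM, hM0⟩ : ∃ M : ℝ, M = 2 ^ (8 * 9 ^ 3 * 3) ∧ 0 < M := ⟨_, rfl, by positivity⟩
  obtain ⟨C, hC, hC0⟩ : ∃ C : ℝ, C = 4 * ((1 + 24 * 9 ^ 7) * 128) ∧ 0 < C :=
    ⟨_, rfl, by positivity⟩
  refine ⟨256 * 9 ^ 10 * 128 + M * (8 * (1 + C)) + C, by positivity,
    fun n hn ε hε F hF hag hμ => ?_⟩
  have hsub : ∀ T S : Finset (Sym2 (Fin n)),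
      (F \ (edgeFinset n).powerset.filter (fun G => G ∩ T = S)) ∪
        ((edgeFinset n).powerset.filter (fun G => G ∩ T = S) \ F) ⊆ (edgeFinset n).powerset :=
    fun T S => Finset.union_subset (Finset.sdiff_subset.trans hF)
      (Finset.sdiff_subset.trans (Finset.filter_subset _ _))
  have hMε : 0 ≤ M * (8 * (1 + C)) * ε := by positivity
  have hCε : 0 ≤ C * ε := by positivity
  rcases lt_or_ge ((256 * 9 ^ 10 * 128 + M * (8 * (1 + C)) + C) * ε) 1 with hsmall | hlarge
  · obtain ⟨T, S, hT, hST, hle⟩ := hag.agreeing_edgeFamily.exists_junta_of_le_mean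
      isTriangleLike_toGraph isCode_cut exists_notMem_cut (muFam_eq_mean hF ▸ hμ)
      (by linarith) (by rw [← hM]; subst hC; linarith)
    refine ⟨toGraph T, toGraph S, hT, Finset.map_subset_map.2 hST, ?_⟩
    rw [muFam_eq_mean (hsub _ _), edgeFamily_symmDiff_junta]
    refine hle.trans ?_
    subst hC
    linarith
  · refine ⟨{s(⟨0, by omega⟩, ⟨1, by omega⟩), s(⟨0, by omega⟩, ⟨2, by omega⟩),
      s(⟨1, by omega⟩, ⟨2, by omega⟩)}, ∅, ⟨_, _, _, ?_, ?_, ?_, rfl⟩, Finset.empty_subset _,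
      (muFam_le_one (hsub _ _)).trans hlarge⟩ <;> simp
end
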